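/- arXiv:1712.03583 — 2 statements merged into one kernel-verified Lean document; each statement's English description precedes it below -/
import Mathlib

section
/- Let C ⊆ ℝ^n be a nonempty convex compact set, f : C × C → ℝ an equilibrium bifunction, K : C ⇉ C a lower semicontinuous set-valued map with nonempty convex values such that fix K is closed, and F(x) := {y ∈ C : f(x,y) < 0}. Assume: (i) F(x) is convex for every x ∈ fix K; (ii) F is lower semicontinuous at every point of fix K; (iii) the intersection map x ↦ F(x) ∩ K(x) is lower semicontinuous at every point of ∂_C fix K. Then the quasiequilibrium problem has a solution: there exists x ∈ K(x) with f(x,y) ≥ 0 for all y ∈ K(x). -/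
open Set Topology Filter

/-- A set-valued map `Φ : X ⇉ Y` is lower semicontinuous at `x` if for every open set `Ω`
with `Φ x ∩ Ω ≠ ∅` there is a neighborhood of `x` on which `Φ x' ∩ Ω ≠ ∅`. -/
def LscAt {X Y : Type*} [TopologicalSpace X] [TopologicalSpace Y]
    (Φ : X → Set Y) (x : X) : Prop :=
  ∀ Ω : Set Y, IsOpen Ω → (Φ x ∩ Ω).Nonempty → ∀ᶠ x' in 𝓝 x, (Φ x' ∩ Ω).Nonempty

/-- Evaluation at `1` of polynomials of bounded degree is a linear combination of evaluations at
arbitrarily small positive points. -/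
theorem exists_interpolation_weights (d : ℕ) {t₀ : ℝ} (ht₀ : 0 < t₀) :
    ∃ v w : Fin (d + 1) → ℝ, (∀ j, 0 < v j ∧ v j ≤ t₀) ∧
      ∀ q : Polynomial ℝ, q.natDegree ≤ d → q.eval 1 = ∑ j, w j * q.eval (v j) := by
  have hinj : Function.Injective (fun j : Fin (d + 1) => t₀ / ((j : ℝ) + 1)) := by
    intro i j hij
    have hi : (0 : ℝ) < (i : ℝ) + 1 := by positivity
    have hj : (0 : ℝ) < (j : ℝ) + 1 := by positivity
    have h := hij
    simp only at h
    rw [div_eq_div_iff hi.ne' hj.ne'] at h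
    have h2 := mul_left_cancel₀ ht₀.ne' h
    apply Fin.ext
    have : (j : ℝ) = i := by linarith
    exact_mod_cast this.symm
  refine ⟨fun j => t₀ / ((j : ℝ) + 1),
    fun j => (Lagrange.basis Finset.univ (fun j : Fin (d + 1) => t₀ / ((j : ℝ) + 1)) j).eval 1,
    fun j => ⟨by positivity, div_le_self ht₀.le (by simp)⟩, fun q hq => ?_⟩
  have hdeg : q.degree < (Finset.univ : Finset (Fin (d + 1))).card := by
    refine lt_of_le_of_lt Polynomial.degree_le_natDegree ?_
    simp only [Finset.card_univ, Fintype.card_fin]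
    exact_mod_cast Nat.lt_succ_of_le hq
  have h := Lagrange.eq_interpolate (s := Finset.univ) hinj.injOn hdeg
  conv_lhs => rw [h]
  rw [Lagrange.interpolate_apply, Polynomial.eval_finsetSum]
  simp [mul_comm]

section Brouwer

variable {E : Type*} [NormedAddCommGroup E] [InnerProductSpace ℝ E] [FiniteDimensional ℝ E]

theorem exists_polynomial_det_one_add_smul (A : E →L[ℝ] E) :
    ∃ q : Polynomial ℝ, q.natDegree ≤ Module.finrank ℝ E ∧
      ∀ t : ℝ, (1 + t • A).det = q.eval t := by
  classical
  let b := Module.finBasis ℝ E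
  let M := LinearMap.toMatrix b b (A : E →ₗ[ℝ] E)
  refine ⟨Matrix.det ((Polynomial.X : Polynomial ℝ) • M.map Polynomial.C +
    (1 : Matrix _ _ ℝ).map Polynomial.C), ?_, fun t => ?_⟩
  · simpa using Polynomial.natDegree_det_X_add_C_le M 1
  · have hM : LinearMap.toMatrix b b ((1 + t • A : E →L[ℝ] E) : E →ₗ[ℝ] E) = t • M + 1 := by
      have : ((1 + t • A : E →L[ℝ] E) : E →ₗ[ℝ] E) = LinearMap.id + t • (A : E →ₗ[ℝ] E) := rfl
      rw [this, map_add, map_smul, LinearMap.toMatrix_id, add_comm]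
    rw [ContinuousLinearMap.det, ← LinearMap.det_toMatrix b, hM, ← Polynomial.coe_evalRingHom,
      RingHom.map_det]
    congr 1
    ext i j
    rcases eq_or_ne i j with rfl | h
    · simp
      ring
    · simp [Matrix.one_apply_ne h]
      ring

theorem ContinuousLinearMap.det_one_add_pos {A : E →L[ℝ] E} (hA : ‖A‖ < 1) : 0 < (1 + A).det := by
  by_contra! hneg
  have hne : ∀ s ∈ Icc (0 : ℝ) 1, (1 + s • A).det ≠ 0 := by
    intro s hs
    have hlt : ‖-(s • A)‖ < 1 := by
      rw [norm_neg, norm_smul, Real.norm_of_nonneg hs.1]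
      nlinarith [hs.2, norm_nonneg A]
    have hu := isUnit_one_sub_of_norm_lt_one hlt
    rw [sub_neg_eq_add] at hu
    obtain ⟨B, hB⟩ := hu.exists_left_inv
    intro h0
    have : (B * (1 + s • A)).det = 1 := by rw [hB]; exact LinearMap.det_id
    have h2 : (B * (1 + s • A)).det = B.det * (1 + s • A).det := LinearMap.det_comp _ _
    rw [h2, h0, mul_zero] at this
    exact zero_ne_one this
  have hcont : ContinuousOn (fun s : ℝ => (1 + s • A).det) (Icc 0 1) := by
    obtain ⟨q, -, hq⟩ := exists_polynomial_det_one_add_smul A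
    simp only [hq]
    exact q.continuous.continuousOn
  have h0 : (1 + (0 : ℝ) • A).det = 1 := by rw [zero_smul, add_zero]; exact LinearMap.det_id
  obtain ⟨s, hs, hs0⟩ := intermediate_value_Icc' zero_le_one hcont
    (show (0 : ℝ) ∈ Icc _ _ from ⟨by simpa using hneg, by rw [h0]; exact zero_le_one⟩)
  exact hne s hs hs0

open MeasureTheory Metric in
/-- There is no `C¹` retraction of the closed unit ball onto the unit sphere. -/
theorem false_of_contDiffOn_retraction {r : E → E} {U : Set E} (hU : IsOpen U)
    (hBU : closedBall 0 1 ⊆ U) (hr : ContDiffOn ℝ 1 r U) (hr1 : ∀ x ∈ closedBall 0 1, ‖r x‖ = 1)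
    (hrid : ∀ x ∈ sphere 0 1, r x = x) : False := by
  borelize E
  let g : E → E := fun x => r x - x
  have hg : ContDiffOn ℝ 1 g U := hr.sub contDiffOn_id
  have hgd : ∀ x ∈ U, HasFDerivAt g (fderiv ℝ g x) x := fun x hx =>
    ((hg.differentiableOn one_ne_zero).differentiableAt (hU.mem_nhds hx)).hasFDerivAt
  have hcont : ContinuousOn (fderiv ℝ g) (closedBall 0 1) :=
    (hg.continuousOn_fderiv_of_isOpen hU le_rfl).mono hBU
  obtain ⟨L, hL⟩ := (isCompact_closedBall (0 : E) 1).exists_bound_of_continuousOn hcont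
  have hLip : ∀ x ∈ closedBall (0 : E) 1, ∀ y ∈ closedBall (0 : E) 1,
      ‖g x - g y‖ ≤ L * ‖x - y‖ := fun x hx y hy =>
    (convex_closedBall (0 : E) 1).norm_image_sub_le_of_norm_fderiv_le
      (fun z hz => (hgd z (hBU hz)).differentiableAt) hL hy hx
  have hL0 : 0 ≤ L := (norm_nonneg _).trans (hL 0 (by simp))
  have hg0 : ∀ x ∈ sphere (0 : E) 1, g x = 0 := fun x hx => by simp [g, hrid x hx]
  have hsmall : ∀ t : ℝ, 0 < t → t ≤ 1 / (2 * (L + 1)) →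
      ∫ x in ball (0 : E) 1, (1 + t • fderiv ℝ g x).det = volume.real (ball (0 : E) 1) := by
    intro t ht0 ht
    have htL : t * (L + 1) ≤ 1 / 2 := by
      rw [le_div_iff₀ (by positivity)] at ht
      linarith
    have ht1 : t < 1 := by nlinarith
    let φ : E → E := fun x => x + t • g x
    have happ : ApproximatesLinearOn φ ((ContinuousLinearEquiv.refl ℝ E : E ≃L[ℝ] E) : E →L[ℝ] E)
        (ball 0 1) (1 / 2) := by
      intro x hx y hy
      have : φ x - φ y - (x - y) = t • (g x - g y) := by simp only [φ, smul_sub]; abel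
      simp only [ContinuousLinearEquiv.coe_refl, ContinuousLinearMap.coe_id', id]
      rw [this, norm_smul, Real.norm_of_nonneg ht0.le]
      have := hLip x (ball_subset_closedBall hx) y (ball_subset_closedBall hy)
      push_cast
      nlinarith [norm_nonneg (x - y), mul_le_mul_of_nonneg_left this ht0.le]
    have hinv : Subsingleton E ∨ (1 / 2 : NNReal) <
        ‖(((ContinuousLinearEquiv.refl ℝ E).symm : E ≃L[ℝ] E) : E →L[ℝ] E)‖₊⁻¹ := by
      rcases subsingleton_or_nontrivial E with h | h
      · exact Or.inl h
      · right
        have : ‖(((ContinuousLinearEquiv.refl ℝ E).symm : E ≃L[ℝ] E) : E →L[ℝ] E)‖₊ = 1 := by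
          simp
        rw [this, inv_one]
        exact NNReal.half_lt_self one_ne_zero
    have hinj : InjOn φ (ball 0 1) := happ.injOn hinv
    have hopen : IsOpen (φ '' ball 0 1) := by
      refine happ.open_image (ContinuousLinearEquiv.toNonlinearRightInverse _) isOpen_ball ?_
      simpa [ContinuousLinearEquiv.toNonlinearRightInverse] using hinv
    have hφball : ∀ x ∈ ball (0 : E) 1, φ x ∈ ball (0 : E) 1 := by
      intro x hx
      have : φ x = (1 - t) • x + t • r x := by simp only [φ, g]; module
      rw [mem_ball_zero_iff] at hx ⊢
      rw [this]
      refine (norm_add_le _ _).trans_lt ?_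
      rw [norm_smul, norm_smul, Real.norm_of_nonneg ht0.le, Real.norm_of_nonneg (by linarith),
        hr1 x (by simpa using hx.le)]
      nlinarith
    have hφcont : ContinuousOn φ (closedBall 0 1) :=
      continuousOn_id.add ((hg.continuousOn.mono hBU).const_smul t)
    have himage : φ '' ball 0 1 = ball 0 1 := by
      apply Subset.antisymm (image_subset_iff.2 (show ball 0 1 ⊆ φ ⁻¹' ball 0 1 from hφball))
      apply (convex_ball (0 : E) 1).isPreconnected.subset_of_closure_inter_subset hopen
      · exact ⟨φ 0, hφball 0 (by simp), 0, by simp, rfl⟩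
      · rintro y ⟨hy, hyb⟩
        have hcl : closure (φ '' ball 0 1) ⊆ φ '' closedBall 0 1 :=
          closure_minimal (image_mono ball_subset_closedBall)
            ((isCompact_closedBall (0 : E) 1).image_of_continuousOn hφcont).isClosed
        obtain ⟨x, hx, rfl⟩ := hcl hy
        refine ⟨x, ?_, rfl⟩
        by_contra hxb
        have hxs : x ∈ sphere (0 : E) 1 := by
          rw [mem_closedBall_zero_iff] at hx
          rw [mem_ball_zero_iff] at hxb
          rw [mem_sphere_zero_iff_norm]
          exact le_antisymm hx (not_lt.1 hxb)
        have : φ x = x := by simp [φ, hg0 x hxs]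
        exact hxb (this ▸ hyb)
    have hderiv : ∀ x ∈ ball (0 : E) 1,
        HasFDerivWithinAt φ (1 + t • fderiv ℝ g x) (ball 0 1) x := fun x hx =>
      ((hasFDerivAt_id x).add
        ((hgd x (hBU (ball_subset_closedBall hx))).const_smul t)).hasFDerivWithinAt
    have hint := integral_image_eq_integral_abs_det_fderiv_smul (volume : Measure E)
      measurableSet_ball hderiv hinj (fun _ => (1 : ℝ))
    rw [himage] at hint
    simp only [setIntegral_const, smul_eq_mul, mul_one] at hint
    rw [hint]
    refine setIntegral_congr_fun measurableSet_ball fun x hx => ?_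
    refine (abs_of_pos (ContinuousLinearMap.det_one_add_pos ?_)).symm
    rw [norm_smul, Real.norm_of_nonneg ht0.le]
    nlinarith [hL x (ball_subset_closedBall hx)]
  have hvol : 0 < volume.real (ball (0 : E) 1) :=
    ENNReal.toReal_pos (measure_ball_pos _ _ one_pos).ne' measure_ball_lt_top.ne
  have hdet : ∀ x ∈ ball (0 : E) 1, (1 + (1 : ℝ) • fderiv ℝ g x).det = 0 := by
    intro x hx
    have hxU := hBU (ball_subset_closedBall hx)
    have hrd : HasFDerivAt r (1 + (1 : ℝ) • fderiv ℝ g x) x := by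
      have h := (hasFDerivAt_id x).add ((hgd x hxU).const_smul (1 : ℝ))
      refine h.congr_of_eventuallyEq (Eventually.of_forall fun y => ?_)
      simp [g]
    by_contra hne
    set A : E →L[ℝ] E := 1 + (1 : ℝ) • fderiv ℝ g x
    have hsurj : Function.Surjective A :=
      (LinearMap.equivOfDetNeZero (A : E →ₗ[ℝ] E) hne).surjective
    obtain ⟨v, hv⟩ := hsurj (r x)
    have h1 := hrd.inner ℝ hrd
    have h2 : HasFDerivAt (fun y => inner ℝ (r y) (r y)) (0 : E →L[ℝ] ℝ) x := by
      refine (hasFDerivAt_const (1 : ℝ) x).congr_of_eventuallyEq ?_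
      filter_upwards [isOpen_ball.mem_nhds hx] with y hy
      rw [real_inner_self_eq_norm_sq, hr1 y (ball_subset_closedBall hy), one_pow]
    have h3 := congrArg (fun T : E →L[ℝ] ℝ => T v) (h1.unique h2)
    simp [hv, hr1 x (ball_subset_closedBall hx)] at h3
  obtain ⟨v, w, hv, hw⟩ := exists_interpolation_weights (Module.finrank ℝ E)
    (t₀ := 1 / (2 * (L + 1))) (by positivity)
  have hwdet : ∀ A : E →L[ℝ] E, (1 + (1 : ℝ) • A).det = ∑ j, w j * (1 + v j • A).det := by
    intro A
    obtain ⟨q, hq, hqA⟩ := exists_polynomial_det_one_add_smul A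
    simp only [hqA]
    exact hw q hq
  have hw1 : ∑ j, w j = 1 := by simpa using (hw 1 (by simp)).symm
  have hintble : ∀ t : ℝ, IntegrableOn (fun x => (1 + t • fderiv ℝ g x).det) (ball 0 1)
      (volume : Measure E) := by
    intro t
    refine IntegrableOn.mono_set ?_ ball_subset_closedBall
    refine ContinuousOn.integrableOn_compact (isCompact_closedBall _ _) ?_
    exact ContinuousLinearMap.continuous_det.comp_continuousOn
      (continuousOn_const.add (hcont.const_smul t))
  have hzero : ∫ x in ball (0 : E) 1, (1 + (1 : ℝ) • fderiv ℝ g x).det = 0 := by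
    rw [setIntegral_congr_fun measurableSet_ball hdet]
    simp
  simp only [hwdet] at hzero
  rw [integral_finsetSum _ fun j _ => (hintble (v j)).const_mul (w j)] at hzero
  simp only [integral_const_mul] at hzero
  rw [Finset.sum_congr rfl fun j _ => by rw [hsmall (v j) (hv j).1 (hv j).2],
    ← Finset.sum_mul, hw1, one_mul] at hzero
  exact hvol.ne' hzero

open Metric in
theorem exists_contDiff_dist_lt_norm_lt_one {f : E → E} (hf : ContinuousOn f (closedBall 0 1))
    (hmaps : MapsTo f (closedBall 0 1) (closedBall 0 1)) {δ : ℝ} (hδ : 0 < δ) :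
    ∃ p : E → E, ContDiff ℝ 1 p ∧ ∀ x ∈ closedBall (0 : E) 1, dist (p x) (f x) < δ ∧ ‖p x‖ < 1 := by
  classical
  let t : E → Set E := fun x => if x ∈ closedBall (0 : E) 1 then ball (f x) δ ∩ ball 0 1 else univ
  have htconv : ∀ x, Convex ℝ (t x) := by
    intro x
    by_cases hx : x ∈ closedBall (0 : E) 1
    · simp only [t, if_pos hx]
      exact (convex_ball _ _).inter (convex_ball _ _)
    · simp only [t, if_neg hx]
      exact convex_univ
  have hloc : ∀ x, ∃ c, ∀ᶠ y in 𝓝 x, c ∈ t y := by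
    intro x
    by_cases hx : x ∈ closedBall (0 : E) 1
    · obtain ⟨η, hη0, hηδ, hη1⟩ : ∃ η : ℝ, 0 < η ∧ η < δ ∧ η < 1 :=
        ⟨min δ 1 / 2, by positivity, by linarith [min_le_left δ 1], by linarith [min_le_right δ 1]⟩
      have hfx : ‖f x‖ ≤ 1 := mem_closedBall_zero_iff.1 (hmaps hx)
      refine ⟨(1 - η) • f x, ?_⟩
      have hd : dist ((1 - η) • f x) (f x) < δ := by
        have : (1 - η) • f x - f x = -(η • f x) := by module
        rw [dist_eq_norm, this, norm_neg, norm_smul, Real.norm_of_nonneg hη0.le]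
        nlinarith
      have hn : (1 - η) • f x ∈ ball (0 : E) 1 := by
        rw [mem_ball_zero_iff, norm_smul, Real.norm_of_nonneg (by linarith)]
        nlinarith
      have hev := (hf x hx).eventually
        ((continuous_const.dist continuous_id).continuousAt.eventually_lt_const hd)
      rw [eventually_nhdsWithin_iff] at hev
      filter_upwards [hev] with y hy
      by_cases hyB : y ∈ closedBall (0 : E) 1
      · simp only [t, if_pos hyB]
        exact ⟨hy hyB, hn⟩
      · simp only [t, if_neg hyB, mem_univ]
    · refine ⟨0, ?_⟩
      filter_upwards [isClosed_closedBall.isOpen_compl.mem_nhds hx] with y hy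
      simp only [t, if_neg hy, mem_univ]
  obtain ⟨p, hp⟩ := exists_contMDiffMap_forall_mem_convex_of_local_const
    (modelWithCornersSelf ℝ E) (n := 1) htconv hloc
  refine ⟨p, p.contMDiff.contDiff, fun x hx => ?_⟩
  have h := hp x
  simp only [t, if_pos hx] at h
  exact ⟨h.1, mem_ball_zero_iff.1 h.2⟩

open Metric in
theorem exists_eq_of_contDiff_of_norm_lt_one {p : E → E} (hp : ContDiff ℝ 1 p)
    (hp1 : ∀ x ∈ closedBall (0 : E) 1, ‖p x‖ < 1) : ∃ x ∈ closedBall (0 : E) 1, p x = x := by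
  by_contra! hne
  let u : E → E := fun x => x - p x
  let D : E → ℝ := fun x => inner ℝ x (u x) ^ 2 + ‖u x‖ ^ 2 * (1 - ‖x‖ ^ 2)
  let s : E → ℝ := fun x => (√(D x) - inner ℝ x (u x)) / ‖u x‖ ^ 2
  have hu : ContDiff ℝ 1 u := contDiff_id.sub hp
  have hb : ContDiff ℝ 1 fun x => inner ℝ x (u x) := contDiff_id.inner ℝ hu
  have hD : ContDiff ℝ 1 D :=
    (hb.pow 2).add ((hu.norm_sq ℝ).mul (contDiff_const.sub (contDiff_id.norm_sq ℝ)))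
  have hu0 : ∀ x, 0 < D x → 0 < ‖u x‖ := by
    intro x hx
    rw [norm_pos_iff]
    intro h
    simp [D, h] at hx
  have hb1 : ∀ x ∈ sphere (0 : E) 1, 0 < inner ℝ x (u x) := by
    intro x hx
    have hx1 : ‖x‖ = 1 := mem_sphere_zero_iff_norm.1 hx
    have h1 := real_inner_le_norm x (p x)
    have h2 := hp1 x (sphere_subset_closedBall hx)
    simp only [u, inner_sub_right, real_inner_self_eq_norm_sq]
    rw [hx1] at h1 ⊢
    linarith
  have hDpos : ∀ x ∈ closedBall (0 : E) 1, 0 < D x := by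
    intro x hx
    rcases (mem_closedBall_zero_iff.1 hx).lt_or_eq with h | h
    · have h1 : 0 < ‖u x‖ := norm_pos_iff.2 (sub_ne_zero.2 (hne x hx).symm)
      have h2 : 0 < 1 - ‖x‖ ^ 2 := by nlinarith [norm_nonneg x]
      positivity
    · have := hb1 x (mem_sphere_zero_iff_norm.2 h)
      simp only [D, h]
      nlinarith
  refine false_of_contDiffOn_retraction (r := fun x => x + s x • u x) (U := {x | 0 < D x})
    (isOpen_lt continuous_const hD.continuous) hDpos ?_ ?_ ?_
  · refine contDiffOn_id.add (ContDiffOn.smul ?_ hu.contDiffOn)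
    refine ContDiffOn.div (ContDiffOn.sub ?_ hb.contDiffOn) (hu.norm_sq ℝ).contDiffOn ?_
    · exact hD.contDiffOn.sqrt fun x hx => (ne_of_gt hx)
    · exact fun x hx => (pow_pos (hu0 x hx) 2).ne'
  · intro x hx
    have hDx := hDpos x hx
    have ha := hu0 x hDx
    have hsq : ‖x + s x • u x‖ ^ 2 = 1 := by
      rw [norm_add_sq_real, real_inner_smul_right, norm_smul, mul_pow, Real.norm_eq_abs, sq_abs]
      have h1 : s x * ‖u x‖ ^ 2 = √(D x) - inner ℝ x (u x) := div_mul_cancel₀ _ (by positivity)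
      have h2 : √(D x) ^ 2 = inner ℝ x (u x) ^ 2 + ‖u x‖ ^ 2 * (1 - ‖x‖ ^ 2) := Real.sq_sqrt hDx.le
      have h3 : ‖u x‖ ^ 2 ≠ 0 := by positivity
      apply mul_left_cancel₀ h3
      linear_combination (s x * ‖u x‖ ^ 2 + √(D x) + inner ℝ x (u x)) * h1 + h2
    nlinarith [norm_nonneg (x + s x • u x)]
  · intro x hx
    have hx1 : ‖x‖ = 1 := mem_sphere_zero_iff_norm.1 hx
    have hs : s x = 0 := by
      simp [s, D, hx1, Real.sqrt_sq (hb1 x hx).le]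
    simp [hs]

open Metric in
/-- **Brouwer's fixed point theorem** for the closed unit ball. -/
theorem exists_eq_of_continuousOn_closedBall {f : E → E} (hf : ContinuousOn f (closedBall 0 1))
    (hmaps : MapsTo f (closedBall 0 1) (closedBall 0 1)) :
    ∃ x ∈ closedBall (0 : E) 1, f x = x := by
  obtain ⟨x₀, hx₀, hmin⟩ := (isCompact_closedBall (0 : E) 1).exists_isMinOn
    (nonempty_closedBall.2 zero_le_one) (hf.sub continuousOn_id).norm
  refine ⟨x₀, hx₀, ?_⟩
  by_contra hne
  obtain ⟨p, hp, hpf⟩ := exists_contDiff_dist_lt_norm_lt_one hf hmaps 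
    (norm_pos_iff.2 (sub_ne_zero.2 hne))
  obtain ⟨x, hx, hpx⟩ := exists_eq_of_contDiff_of_norm_lt_one hp fun x hx => (hpf x hx).2
  have h1 := (hpf x hx).1
  have h2 : ‖f x₀ - x₀‖ ≤ ‖f x - x‖ := hmin hx
  rw [hpx, dist_comm, dist_eq_norm] at h1
  exact h1.not_ge h2

end Brouwer

section LscAt

variable {X Y : Type*} [TopologicalSpace X]

theorem LscAt.congr [TopologicalSpace Y] {Φ Ψ : X → Set Y} {x : X} (h : LscAt Φ x)
    (hx : Φ =ᶠ[𝓝 x] Ψ) : LscAt Ψ x := by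
  intro Ω hΩ hne
  rw [← hx.eq_of_nhds] at hne
  filter_upwards [h Ω hΩ hne, hx] with z hz hzx
  rwa [← hzx]

theorem LscAt.update_singleton [T1Space X] [TopologicalSpace Y] [DecidableEq X] {Φ : X → Set Y}
    {x : X} (h : LscAt Φ x) {x₀ : X} {y₀ : Y} (hy₀ : y₀ ∈ Φ x₀) :
    LscAt (Function.update Φ x₀ {y₀}) x := by
  intro Ω hΩ hne
  rcases eq_or_ne x x₀ with rfl | hx
  · simp only [Function.update_self, singleton_inter_nonempty] at hne
    filter_upwards [h Ω hΩ ⟨y₀, hy₀, hne⟩] with z hz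
    rcases eq_or_ne z x with rfl | hzx
    · simpa using hne
    · rwa [Function.update_of_ne hzx]
  · rw [Function.update_of_ne hx] at hne
    filter_upwards [h Ω hΩ hne, isOpen_ne.mem_nhds hx] with z hz hzx
    rwa [Function.update_of_ne hzx]

theorem LscAt.inter_ball [PseudoMetricSpace Y] {Φ : X → Set Y} {x : X} (h : LscAt Φ x)
    {g : X → Y} (hg : ContinuousAt g x) (ε : ℝ) :
    LscAt (fun z => Φ z ∩ Metric.ball (g z) ε) x := by
  rintro Ω hΩ ⟨y, ⟨hyΦ, hyg⟩, hyΩ⟩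
  rw [Metric.mem_ball] at hyg
  have hδ : 0 < (ε - dist y (g x)) / 2 := by linarith
  have hopen := hΩ.inter (Metric.isOpen_ball (x := y) (ε := (ε - dist y (g x)) / 2))
  filter_upwards [h _ hopen ⟨y, hyΦ, hyΩ, Metric.mem_ball_self hδ⟩,
    hg.eventually (Metric.ball_mem_nhds _ hδ)] with z hz hgz
  obtain ⟨y', hy'Φ, hy'Ω, hy'⟩ := hz
  refine ⟨y', ⟨hy'Φ, ?_⟩, hy'Ω⟩
  rw [Metric.mem_ball] at hy' ⊢
  have h1 := dist_triangle4 y' y (g x) (g z)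
  rw [dist_comm (g x)] at h1
  linarith

variable [NormedAddCommGroup Y] [NormedSpace ℝ Y] {Φ : X → Set Y}

theorem exists_continuousMap_mem_thickening [NormalSpace X] [ParacompactSpace X]
    (hΦ : ∀ x, LscAt Φ x) (hne : ∀ x, (Φ x).Nonempty) (hconv : ∀ x, Convex ℝ (Φ x))
    {ε : ℝ} (hε : 0 < ε) : ∃ g : C(X, Y), ∀ x, g x ∈ Metric.thickening ε (Φ x) := by
  refine exists_continuous_forall_mem_convex_of_local_const
    (fun x => (hconv x).thickening ε) fun x => ?_
  obtain ⟨y, hy⟩ := hne x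
  refine ⟨y, ?_⟩
  filter_upwards [hΦ x _ Metric.isOpen_ball ⟨y, hy, Metric.mem_ball_self hε⟩] with z hz
  obtain ⟨y', hy'Φ, hy'⟩ := hz
  exact Metric.mem_thickening_iff.2 ⟨y', hy'Φ, by rwa [dist_comm]⟩

theorem exists_continuousMap_mem_thickening_dist_le [NormalSpace X] [ParacompactSpace X]
    (hΦ : ∀ x, LscAt Φ x) (hconv : ∀ x, Convex ℝ (Φ x)) {ε δ : ℝ} (hδ : 0 < δ)
    (g : C(X, Y)) (hg : ∀ x, g x ∈ Metric.thickening ε (Φ x)) :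
    ∃ g' : C(X, Y), (∀ x, g' x ∈ Metric.thickening δ (Φ x)) ∧
      ∀ x, dist (g x) (g' x) ≤ ε + δ := by
  obtain ⟨g', hg'⟩ := exists_continuousMap_mem_thickening
    (Φ := fun z => Φ z ∩ Metric.ball (g z) ε)
    (fun x => (hΦ x).inter_ball g.continuous.continuousAt ε)
    (fun x => by
      obtain ⟨y, hy, hyg⟩ := Metric.mem_thickening_iff.1 (hg x)
      exact ⟨y, hy, by rwa [Metric.mem_ball, dist_comm]⟩)
    (fun x => (hconv x).inter (convex_ball _ _)) hδ
  refine ⟨g', fun x => Metric.thickening_subset_of_subset _ inter_subset_left (hg' x), fun x => ?_⟩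
  obtain ⟨y, ⟨-, hyg⟩, hy⟩ := Metric.mem_thickening_iff.1 (hg' x)
  have h1 := dist_triangle (g x) y (g' x)
  rw [Metric.mem_ball, dist_comm] at hyg
  rw [dist_comm (g' x)] at hy
  linarith

/-- **Michael's selection theorem** over a compact space. -/
theorem exists_continuousMap_mem_closure [T2Space X] [CompactSpace X] [CompleteSpace Y]
    (hΦ : ∀ x, LscAt Φ x) (hne : ∀ x, (Φ x).Nonempty) (hconv : ∀ x, Convex ℝ (Φ x)) :
    ∃ g : C(X, Y), ∀ x, g x ∈ closure (Φ x) := by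
  obtain ⟨g₀, hg₀⟩ := exists_continuousMap_mem_thickening hΦ hne hconv
    (pow_pos (one_half_pos (α := ℝ)) 0)
  choose! next hnext hdist using fun (n : ℕ) (g : C(X, Y))
    (hg : ∀ x, g x ∈ Metric.thickening ((1 / 2 : ℝ) ^ n) (Φ x)) =>
    exists_continuousMap_mem_thickening_dist_le hΦ hconv
      (pow_pos (one_half_pos (α := ℝ)) (n + 1)) g hg
  let g : ℕ → C(X, Y) := fun n => Nat.rec g₀ next n
  have hg : ∀ n x, g n x ∈ Metric.thickening ((1 / 2 : ℝ) ^ n) (Φ x) := by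
    intro n
    induction n with
    | zero => exact hg₀
    | succ n ih => exact hnext n (g n) ih
  have hcauchy : CauchySeq g := by
    refine cauchySeq_of_le_geometric (1 / 2) 2 (by norm_num) fun n => ?_
    rw [ContinuousMap.dist_le (by positivity)]
    intro x
    refine (hdist n (g n) (hg n) x).trans ?_
    rw [pow_succ]
    have : (0 : ℝ) < (1 / 2) ^ n := by positivity
    linarith
  obtain ⟨G, hG⟩ := cauchySeq_tendsto_of_complete hcauchy
  refine ⟨G, fun x => Metric.mem_closure_iff.2 fun ε hε => ?_⟩
  have hGx : Tendsto (fun n => g n x) atTop (𝓝 (G x)) :=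
    ((continuous_eval_const x).tendsto G).comp hG
  have hpow : Tendsto (fun n : ℕ => (1 / 2 : ℝ) ^ n) atTop (𝓝 0) :=
    tendsto_pow_atTop_nhds_zero_of_lt_one (by norm_num) (by norm_num)
  obtain ⟨n, hn1, hn2⟩ := ((hGx.eventually (Metric.ball_mem_nhds _ (half_pos hε))).and
    (hpow.eventually (gt_mem_nhds (half_pos hε)))).exists
  obtain ⟨y, hy, hyg⟩ := Metric.mem_thickening_iff.1 (hg n x)
  refine ⟨y, hy, ?_⟩
  rw [dist_comm] at hn1
  linarith [dist_triangle (G x) (g n x) y]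

theorem exists_continuousMap_mem_closure_eq [T2Space X] [CompactSpace X] [CompleteSpace Y]
    (hΦ : ∀ x, LscAt Φ x) (hne : ∀ x, (Φ x).Nonempty) (hconv : ∀ x, Convex ℝ (Φ x))
    {x₀ : X} {y₀ : Y} (hy₀ : y₀ ∈ Φ x₀) :
    ∃ g : C(X, Y), (∀ x, g x ∈ closure (Φ x)) ∧ g x₀ = y₀ := by
  classical
  obtain ⟨g, hg⟩ := exists_continuousMap_mem_closure (Φ := Function.update Φ x₀ {y₀})
    (fun x => (hΦ x).update_singleton hy₀)
    (fun x => by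
      rcases eq_or_ne x x₀ with rfl | hx
      · simp
      · rw [Function.update_of_ne hx]; exact hne x)
    (fun x => by
      rcases eq_or_ne x x₀ with rfl | hx
      · simp
      · rw [Function.update_of_ne hx]; exact hconv x)
  have h₀ : g x₀ = y₀ := by simpa using hg x₀
  refine ⟨g, fun x => ?_, h₀⟩
  rcases eq_or_ne x x₀ with rfl | hx
  · rw [h₀]; exact subset_closure hy₀
  · have := hg x
    rwa [Function.update_of_ne hx] at this

end LscAt

section Convex

variable {F : Type*} [NormedAddCommGroup F] [NormedSpace ℝ F] {A : Set F} {z : ℕ → F}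
  {c : ℕ → ℝ} {w : F}

theorem Convex.mem_of_hasSum_of_interior_nonempty (hA : Convex ℝ A) (hint : (interior A).Nonempty)
    (hz : ∀ i, z i ∈ closure A) (hAz : A ⊆ closure (range z)) (hc : ∀ i, 0 < c i)
    (hc1 : HasSum c 1) (hw : HasSum (fun i => c i • z i) w) : w ∈ A := by
  by_contra hwA
  obtain ⟨l, hl⟩ := geometric_hahn_banach_open_point hA.interior isOpen_interior
    fun h => hwA (interior_subset h)
  have hle : ∀ a ∈ closure A, l a ≤ l w := by
    rw [← hA.closure_interior_eq_closure_of_nonempty_interior hint]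
    exact fun a ha => closure_minimal (fun b hb => (hl b hb).le)
      (isClosed_le l.continuous continuous_const) ha
  have hsum : HasSum (fun i => c i * (l w - l (z i))) 0 := by
    have h1 := (hc1.mul_right (l w)).sub (l.hasSum hw)
    simp only [map_smul, smul_eq_mul, one_mul, sub_self, ← mul_sub] at h1
    exact h1
  rw [hasSum_zero_iff_of_nonneg fun i =>
    mul_nonneg (hc i).le (sub_nonneg.2 (hle _ (hz i)))] at hsum
  have hlz : ∀ i, l (z i) = l w := fun i => by
    have := congrFun hsum i
    simp only [Pi.zero_apply, mul_eq_zero, (hc i).ne', false_or] at this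
    linarith
  obtain ⟨a, ha⟩ := hint
  have hcl : closure (range z) ⊆ {b | l b = l w} :=
    closure_minimal (range_subset_iff.2 hlz) (isClosed_eq l.continuous continuous_const)
  exact (hl a ha).ne (hcl (hAz (interior_subset ha)))

/-- A convex combination with positive weights of a sequence that is dense in a finite-dimensional
convex set lies in that set, even if the terms belong only to its closure. -/
theorem Convex.mem_of_hasSum_of_subset_closure_range [FiniteDimensional ℝ F] (hA : Convex ℝ A)
    (hne : A.Nonempty)
    (hz : ∀ i, z i ∈ closure A) (hAz : A ⊆ closure (range z)) (hc : ∀ i, 0 < c i)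
    (hc1 : HasSum c 1) (hw : HasSum (fun i => c i • z i) w) : w ∈ A := by
  obtain ⟨a, ha⟩ := hne
  let A' : Set F := (fun x => x - a) '' A
  let V : Submodule ℝ F := Submodule.span ℝ A'
  let B : Set V := (↑) ⁻¹' A'
  obtain ⟨P₀, hP₀⟩ := LinearMap.exists_leftInverse_of_injective V.subtype V.ker_subtype
  let P : F →L[ℝ] V := LinearMap.toContinuousLinearMap P₀
  have hP : ∀ v : V, P v = v := fun v => congrArg (fun T : V →ₗ[ℝ] V => T v) hP₀
  have hPV : ∀ v ∈ V, (P v : F) = v := fun v hv => congrArg Subtype.val (hP ⟨v, hv⟩)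
  have hAV : ∀ x ∈ A, x - a ∈ V := fun x hx => Submodule.subset_span ⟨x, hx, rfl⟩
  have hBA : ∀ x ∈ A, P (x - a) ∈ B := fun x hx => by
    change (P (x - a) : F) ∈ A'
    rw [hPV _ (hAV x hx)]
    exact ⟨x, hx, rfl⟩
  have hcont : Continuous fun x => P (x - a) := P.continuous.comp (continuous_id.sub continuous_const)
  have hB : Convex ℝ B := by
    have : Convex ℝ A' := by
      have := hA.translate (-a)
      simpa only [A', sub_eq_add_neg, add_comm _ (-a)] using this
    exact this.linear_preimage V.subtype
  have h0B : (0 : V) ∈ B := ⟨a, ha, by simp⟩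
  have hint : (interior B).Nonempty := by
    rw [hB.interior_nonempty_iff_affineSpan_eq_top,
      AffineSubspace.affineSpan_eq_top_iff_vectorSpan_eq_top_of_nonempty ℝ V V ⟨0, h0B⟩,
      vectorSpan_eq_span_vsub_set_right ℝ h0B]
    simpa only [vsub_eq_sub, sub_zero, image_id'] using
      Submodule.span_span_coe_preimage (R := ℝ) (s := A')
  have hsub : HasSum (fun i => c i • (z i - a)) (w - a) := by
    have := hw.sub (hc1.smul_const a)
    simpa only [smul_sub, one_smul] using this
  have hwB : P (w - a) ∈ B := by
    refine hB.mem_of_hasSum_of_interior_nonempty (z := fun i => P (z i - a)) hint (fun i => ?_)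
      (fun v hv => ?_) hc hc1 ?_
    · exact map_mem_closure (f := fun x => P (x - a)) hcont (hz i) hBA
    · obtain ⟨x, hx, hxv⟩ := hv
      have : P (x - a) = v := by
        rw [← hP v, ← hxv]
      rw [← this]
      exact map_mem_closure (f := fun x => P (x - a)) hcont (hAz hx) (by rintro _ ⟨i, rfl⟩; exact ⟨i, rfl⟩)
    · simpa only [map_smul] using P.hasSum hsub
  have hwV : w - a ∈ V := by
    have hzV : ∀ i, z i - a ∈ V := fun i =>
      closure_minimal (t := {x | x - a ∈ V}) hAV
        (V.closed_of_finiteDimensional.preimage (continuous_id.sub continuous_const)) (hz i)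
    have h1 := (V.subtypeL.comp P).hasSum hsub
    have h2 : ∀ i, (V.subtypeL.comp P) (c i • (z i - a)) = c i • (z i - a) := fun i =>
      hPV _ (V.smul_mem _ (hzV i))
    simp only [h2] at h1
    rw [hsub.unique h1]
    exact (P (w - a)).2
  have h : (P (w - a) : F) ∈ A' := hwB
  rw [hPV _ hwV] at h
  obtain ⟨x, hx, hxw⟩ := h
  rwa [← sub_left_injective hxw]

end Convex

section Selection

variable {F : Type*} [NormedAddCommGroup F] [NormedSpace ℝ F] [FiniteDimensional ℝ F]

/-- **Michael's selection theorem** for finite-dimensional values that need not be closed. -/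
theorem exists_continuousMap_mem {X : Type*} [TopologicalSpace X] [T2Space X] [CompactSpace X]
    [SecondCountableTopology X] {Φ : X → Set F} (hΦ : ∀ x, LscAt Φ x)
    (hne : ∀ x, (Φ x).Nonempty) (hconv : ∀ x, Convex ℝ (Φ x))
    (hbdd : Bornology.IsBounded (⋃ x, Φ x)) : ∃ g : C(X, F), ∀ x, g x ∈ Φ x := by
  have : ProperSpace F := FiniteDimensional.proper ℝ F
  obtain ⟨R, hR0, hR⟩ := hbdd.exists_pos_norm_le
  let S : Set C(X, F) := {g | ∀ x, g x ∈ closure (Φ x)}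
  have : Nonempty S := nonempty_subtype.2 (exists_continuousMap_mem_closure hΦ hne hconv)
  let g : ℕ → C(X, F) := fun i => TopologicalSpace.denseSeq S i
  have hg : ∀ i x, g i x ∈ closure (Φ x) := fun i => (TopologicalSpace.denseSeq S i).2
  have hgR : ∀ i, ‖g i‖ ≤ R := fun i => (ContinuousMap.norm_le _ hR0.le).2 fun x =>
    mem_closedBall_zero_iff.1 <| closure_minimal (t := Metric.closedBall 0 R)
      (fun y hy => mem_closedBall_zero_iff.2 (hR y (mem_iUnion.2 ⟨x, hy⟩)))
      Metric.isClosed_closedBall (hg i x)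
  have hsum : Summable fun i => (1 / 2 / 2 ^ i : ℝ) • g i := by
    refine Summable.of_norm_bounded ((hasSum_geometric_two' 1).summable.mul_right R) fun i => ?_
    rw [norm_smul, Real.norm_of_nonneg (by positivity)]
    exact mul_le_mul_of_nonneg_left (hgR i) (by positivity)
  obtain ⟨h, hh⟩ := hsum
  refine ⟨h, fun x => ?_⟩
  refine (hconv x).mem_of_hasSum_of_subset_closure_range (z := fun i => g i x) (hne x)
    (fun i => hg i x) (fun y hy => ?_) (c := fun i => 1 / 2 / 2 ^ i) (fun i => by positivity)
    (hasSum_geometric_two' 1) ?_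
  · obtain ⟨G, hG, rfl⟩ := exists_continuousMap_mem_closure_eq hΦ hne hconv hy
    exact map_mem_closure (f := fun k : S => (k : C(X, F)) x)
      ((continuous_eval_const x).comp continuous_subtype_val)
      (TopologicalSpace.denseRange_denseSeq S ⟨G, hG⟩)
      (by rintro _ ⟨i, rfl⟩; exact ⟨i, rfl⟩)
  · exact ContinuousMap.hasSum_apply hh x

/-- A lower semicontinuous map with nonempty convex values from a nonempty compact convex subset
of a finite-dimensional space to itself has a fixed point. -/
theorem exists_mem_of_forall_lscAt {C : Set F} (hCne : C.Nonempty) (hCcomp : IsCompact C)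
    (hCconv : Convex ℝ C) {G : C → Set C} (hG : ∀ x, LscAt G x) (hne : ∀ x, (G x).Nonempty)
    (hconv : ∀ x, Convex ℝ (Subtype.val '' G x)) : ∃ x, x ∈ G x := by
  obtain ⟨e, he⟩ : ∃ e : F ≃L[ℝ] EuclideanSpace ℝ (Fin (Module.finrank ℝ F)),
      ∀ y ∈ C, e y ∈ Metric.closedBall 0 1 := by
    obtain ⟨R, hR0, hR⟩ :=
      (hCcomp.image (toEuclidean (E := F)).continuous).isBounded.exists_pos_norm_le
    refine ⟨toEuclidean.trans (LinearEquiv.smulOfNeZero ℝ _ R⁻¹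
      (inv_ne_zero hR0.ne')).toContinuousLinearEquiv, fun y hy => ?_⟩
    have h : ‖R⁻¹ • toEuclidean y‖ ≤ 1 := by
      rw [norm_smul, Real.norm_of_nonneg (by positivity), inv_mul_le_iff₀ hR0, mul_one]
      exact hR _ (mem_image_of_mem _ hy)
    exact mem_closedBall_zero_iff.2 h
  let X := Metric.closedBall (0 : EuclideanSpace ℝ (Fin (Module.finrank ℝ F))) 1
  have : CompactSpace X := isCompact_iff_compactSpace.1 (isCompact_closedBall _ _)
  let Φ : X → Set F := fun x =>
    {y | ∃ hy : y ∈ C, ∀ hx : e.symm x ∈ C, (⟨y, hy⟩ : C) ∈ G ⟨e.symm x, hx⟩}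
  have hΦ_of_mem : ∀ x : X, ∀ hx : e.symm x ∈ C, Φ x = Subtype.val '' G ⟨e.symm x, hx⟩ := by
    intro x hx
    ext y
    simp [Φ, hx]
  have hΦ_of_notMem : ∀ x : X, e.symm x ∉ C → Φ x = C := by
    intro x hx
    ext y
    simp [Φ, hx]
  have hcont : Continuous fun x : X => e.symm x := e.symm.continuous.comp continuous_subtype_val
  have hΦlsc : ∀ x, LscAt Φ x := by
    rintro x Ω hΩ ⟨y, ⟨hyC, hy⟩, hyΩ⟩
    by_cases hx : e.symm x ∈ C
    · have h := hG ⟨e.symm x, hx⟩ _ (hΩ.preimage continuous_subtype_val) ⟨⟨y, hyC⟩, hy hx, hyΩ⟩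
      rw [nhds_subtype_eq_comap, eventually_comap] at h
      filter_upwards [hcont.continuousAt.eventually h] with x' hx'
      by_cases hx'C : e.symm x' ∈ C
      · obtain ⟨y', hy', hy'Ω⟩ := hx' ⟨_, hx'C⟩ rfl
        rw [hΦ_of_mem x' hx'C]
        exact ⟨y', mem_image_of_mem _ hy', hy'Ω⟩
      · rw [hΦ_of_notMem x' hx'C]
        exact ⟨y, hyC, hyΩ⟩
    · filter_upwards [hcont.continuousAt.eventually (hCcomp.isClosed.isOpen_compl.mem_nhds hx)]
        with x' hx'
      rw [hΦ_of_notMem x' hx']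
      exact ⟨y, hyC, hyΩ⟩
  have hΦC : ∀ x, Φ x ⊆ C := fun x y hy => hy.1
  obtain ⟨h, hh⟩ := exists_continuousMap_mem hΦlsc
    (fun x => by
      by_cases hx : e.symm x ∈ C
      · rw [hΦ_of_mem x hx]; exact (hne _).image _
      · rwa [hΦ_of_notMem x hx])
    (fun x => by
      by_cases hx : e.symm x ∈ C
      · rw [hΦ_of_mem x hx]; exact hconv _
      · rwa [hΦ_of_notMem x hx])
    (hCcomp.isBounded.subset (iUnion_subset hΦC))
  classical
  obtain ⟨x, hx, hfx⟩ := exists_eq_of_continuousOn_closedBall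
    (f := fun x => if hx : x ∈ X then e (h ⟨x, hx⟩) else 0)
    (by
      rw [continuousOn_iff_continuous_domRestrict]
      refine (e.continuous.comp h.continuous).congr fun x => ?_
      have hx : (x : EuclideanSpace ℝ _) ∈ X := x.2
      simp [hx])
    (fun x hx => by
      have hx' : x ∈ X := hx
      simp only [hx', dif_pos]
      exact he _ (hΦC _ (hh _)))
  have hxX : x ∈ X := hx
  simp only [hxX, dif_pos] at hfx
  obtain ⟨hyC, hy⟩ := hh ⟨x, hxX⟩
  have hex : e.symm x = h ⟨x, hxX⟩ := e.symm_apply_eq.2 hfx.symm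
  have hxC : e.symm x ∈ C := hex ▸ hyC
  have hmem := hy hxC
  refine ⟨⟨e.symm x, hxC⟩, ?_⟩
  convert hmem using 1
  exact Subtype.ext hex

end Selection

/-- Existence of solutions for quasiequilibrium problems (Theorem 3.1): `C ⊆ ℝⁿ` nonempty
convex compact, `f` an equilibrium bifunction, `K` lower semicontinuous with nonempty convex
values and closed fixed point set, `F x := {y ∈ C : f x y < 0}` convex-valued and lower
semicontinuous on `fix K`, and `F ∩ K` lower semicontinuous on `∂_C fix K`. Then there is
`x ∈ K x` with `f x y ≥ 0` for all `y ∈ K x`. -/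
theorem quasiequilibrium_existence {n : ℕ} {C : Set (Fin n → ℝ)}
    (hCne : C.Nonempty) (hCconv : Convex ℝ C) (hCcomp : IsCompact C)
    (f : C → C → ℝ) (hdiag : ∀ x : C, f x x = 0)
    (K : C → Set C)
    (hKlsc : ∀ x : C, LscAt K x)
    (hKne : ∀ x : C, (K x).Nonempty)
    (hKconv : ∀ x : C, Convex ℝ (Subtype.val '' K x))
    (hfix : IsClosed {x : C | x ∈ K x})
    (F : C → Set C) (hF : ∀ x : C, F x = {y : C | f x y < 0})
    (hFconv : ∀ x ∈ {x : C | x ∈ K x}, Convex ℝ (Subtype.val '' F x))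
    (hFlsc : ∀ x ∈ {x : C | x ∈ K x}, LscAt F x)
    (hFKlsc : ∀ x ∈ frontier {x : C | x ∈ K x}, LscAt (fun z => F z ∩ K z) x) :
    ∃ x : C, x ∈ K x ∧ ∀ y ∈ K x, 0 ≤ f x y := by
  classical
  by_contra! hno
  let G : C → Set C := fun x =>
    if x ∈ K x then (if x ∈ interior {x : C | x ∈ K x} then F x else F x ∩ K x) else K x
  have hFK : ∀ x, x ∈ K x → (F x ∩ K x).Nonempty := fun x hx => by
    obtain ⟨y, hy, hfy⟩ := hno x hx
    exact ⟨y, by rw [hF]; exact hfy, hy⟩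
  have hFKG : ∀ x, F x ∩ K x ⊆ G x := by
    intro x
    simp only [G]
    split_ifs
    exacts [inter_subset_left, Subset.rfl, inter_subset_right]
  have hGlsc : ∀ x, LscAt G x := by
    intro x
    by_cases hx : x ∈ K x
    · by_cases hxi : x ∈ interior {x : C | x ∈ K x}
      · refine (hFlsc x hx).congr ?_
        filter_upwards [isOpen_interior.mem_nhds hxi] with z hz
        have hzK : z ∈ K z := by simpa using interior_subset hz
        simp only [G, if_pos hz, if_pos hzK]
      · have hlsc := hFKlsc x ⟨subset_closure hx, hxi⟩
        intro Ω hΩ hne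
        simp only [G, if_pos hx, if_neg hxi] at hne
        filter_upwards [hlsc Ω hΩ hne] with z hz
        exact hz.mono (inter_subset_inter_left _ (hFKG z))
    · refine (hKlsc x).congr ?_
      filter_upwards [hfix.isOpen_compl.mem_nhds hx] with z hz
      have hzK : z ∉ K z := hz
      simp only [G, if_neg hzK]
  have hGne : ∀ x, (G x).Nonempty := by
    intro x
    by_cases hx : x ∈ K x
    · exact (hFK x hx).mono (hFKG x)
    · simp only [G, if_neg hx]
      exact hKne x
  have hGconv : ∀ x, Convex ℝ (Subtype.val '' G x) := by
    intro x
    simp only [G]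
    split_ifs with hx hxi
    · exact hFconv x hx
    · rw [image_inter Subtype.val_injective]
      exact (hFconv x hx).inter (hKconv x)
    · exact hKconv x
  obtain ⟨x, hx⟩ := exists_mem_of_forall_lscAt hCne hCcomp hCconv hGlsc hGne hGconv
  have hxK : x ∈ K x := by
    by_contra hxK
    simp only [G, if_neg hxK] at hx
    exact hxK hx
  have hxF : x ∈ F x := by
    simp only [G, if_pos hxK] at hx
    split_ifs at hx
    exacts [hx, hx.1]
  rw [hF] at hxF
  exact (hdiag x ▸ hxF : (0 : ℝ) < 0).false
end

section
/- Let C ⊆ ℝ^n be a nonempty convex compact set, K : C ⇉ C a lower semicontinuous set-valued map with nonempty convex values such that fix K is closed, f : C × C → ℝ a bifunction satisfying the weakened diagonal condition f(x,x) ≥ 0 for all x ∈ fix K, and F(x) := {y ∈ C : f(x,y) < 0}. Assume: (i) F(x) is convex for every x ∈ fix K; (ii) F is lower semicontinuous at every point of fix K; (iii) x ↦ F(x) ∩ K(x) is lower semicontinuous at every point of ∂_C fix K. Then there exists x ∈ K(x) with f(x,y) ≥ 0 for all y ∈ K(x). -/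
open Set Topology Filter

/-- Lagrange interpolation of the polynomial `t ↦ det (1 + t • A)` at `t = 1`. -/
theorem ContinuousLinearMap.det_one_add_eq_sum_lagrange {E : Type*} [NormedAddCommGroup E]
    [NormedSpace ℝ E] [FiniteDimensional ℝ E] {v : ℕ → ℝ} (hv : Function.Injective v)
    (A : E →L[ℝ] E) :
    (1 + A).det = ∑ j ∈ Finset.range (Module.finrank ℝ E + 1),
      (Lagrange.basis (Finset.range (Module.finrank ℝ E + 1)) v j).eval 1 *
        (1 + v j • A).det := by
  classical
  set s := Finset.range (Module.finrank ℝ E + 1) with hs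
  let b := Module.finBasis ℝ E
  let M := LinearMap.toMatrix b b (A : E →ₗ[ℝ] E)
  let p : Polynomial ℝ := ((Polynomial.X : Polynomial ℝ) • M.map Polynomial.C +
    (1 : Matrix _ _ ℝ).map Polynomial.C).det
  have hp (t : ℝ) : p.eval t = (1 + t • A).det := by
    have h1 : (1 + t • A).det = (1 + t • M).det := by
      rw [ContinuousLinearMap.det, ← LinearMap.det_toMatrix b]
      congr 1
      have : ((1 + t • A : E →L[ℝ] E) : E →ₗ[ℝ] E) = LinearMap.id + t • (A : E →ₗ[ℝ] E) := rfl
      rw [this, map_add, map_smul, LinearMap.toMatrix_id]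
    rw [h1, ← Polynomial.coe_evalRingHom, RingHom.map_det]
    congr 1
    ext i j
    rcases eq_or_ne i j with rfl | hij
    · simp [mul_comm t, add_comm]
    · simp [hij, mul_comm t]
  have hdeg : p.degree < s.card := by
    rw [hs, Finset.card_range]
    refine lt_of_le_of_lt Polynomial.degree_le_natDegree ?_
    have := Polynomial.natDegree_det_X_add_C_le M 1
    rw [Fintype.card_fin] at this
    exact_mod_cast Nat.lt_succ_of_le this
  have h := congrArg (Polynomial.eval 1) (Lagrange.eq_interpolate (hv.injOn (s := s)) hdeg)
  rw [hp, one_smul, Lagrange.interpolate_apply, Polynomial.eval_finsetSum] at h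
  rw [h]
  refine Finset.sum_congr rfl fun j _ => ?_
  rw [Polynomial.eval_mul, Polynomial.eval_C, hp, mul_comm]

/-- A small Lipschitz perturbation of the identity that vanishes on the sphere maps the
closed ball bijectively onto itself. -/
theorem bijOn_closedBall_add_smul {E : Type*} [NormedAddCommGroup E] [NormedSpace ℝ E]
    [CompleteSpace E] {R L t : ℝ} (hR : 0 < R) (hL : 0 ≤ L) {w : E → E}
    (hw : ∀ x, ‖x‖ ≤ R → ∀ y, ‖y‖ ≤ R → ‖w x - w y‖ ≤ L * ‖x - y‖)
    (hw0 : ∀ x, ‖x‖ = R → w x = 0) (hwB : ∀ x, ‖x‖ ≤ R → ‖x + w x‖ ≤ R)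
    (ht0 : 0 ≤ t) (ht1 : t ≤ 1) (htL : t * (2 * L) < 1) :
    BijOn (fun x => x + t • w x) (Metric.closedBall 0 R) (Metric.closedBall 0 R) := by
  classical
  let u : E → E := fun x => if ‖x‖ ≤ R then w x else 0
  have hmix (x z : E) (hx : ‖x‖ ≤ R) (hz : ¬ ‖z‖ ≤ R) : ‖w x‖ ≤ 2 * L * ‖x - z‖ := by
    push Not at hz
    have hz0 : 0 < ‖z‖ := hR.trans hz
    have hp : ‖(R / ‖z‖) • z‖ = R := by
      rw [norm_smul, Real.norm_of_nonneg (by positivity)]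
      field_simp
    have h1 := hw x hx _ hp.le
    rw [hw0 _ hp, sub_zero] at h1
    have h2 : ‖z - (R / ‖z‖) • z‖ = ‖z‖ - R := by
      have : z - (R / ‖z‖) • z = (1 - R / ‖z‖) • z := by rw [sub_smul, one_smul]
      rw [this, norm_smul, Real.norm_of_nonneg]
      · field_simp
      · rw [sub_nonneg, div_le_one hz0]; exact hz.le
    have h3 : ‖z‖ - ‖x‖ ≤ ‖x - z‖ := by rw [norm_sub_rev]; exact norm_sub_norm_le z x
    have h4 := norm_add_le (x - z) (z - (R / ‖z‖) • z)
    rw [sub_add_sub_cancel] at h4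
    nlinarith
  have hu (x y : E) : ‖u x - u y‖ ≤ 2 * L * ‖x - y‖ := by
    have hn := norm_nonneg (x - y)
    by_cases hx : ‖x‖ ≤ R <;> by_cases hy : ‖y‖ ≤ R <;> simp only [u, hx, hy, if_true, if_false]
    · have := hw x hx y hy
      nlinarith [mul_nonneg hL hn]
    · simpa using hmix x y hx hy
    · rw [zero_sub, norm_neg, norm_sub_rev]
      exact hmix y x hy hx
    · rw [sub_self, norm_zero]
      positivity
  refine ⟨fun x hx => ?_, fun x hx y hy hxy => ?_, fun y hy => ?_⟩
  · rw [mem_closedBall_zero_iff] at hx ⊢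
    have : x + t • w x = (1 - t) • x + t • (x + w x) := by module
    change ‖x + t • w x‖ ≤ R
    rw [this]
    have h1 := norm_add_le ((1 - t) • x) (t • (x + w x))
    rw [norm_smul, norm_smul, Real.norm_of_nonneg ht0, Real.norm_of_nonneg (sub_nonneg.2 ht1)]
      at h1
    nlinarith [hwB x hx]
  · rw [mem_closedBall_zero_iff] at hx hy
    have h1 : x - y = t • (w y - w x) := by
      have hxy : x + t • w x = y + t • w y := hxy
      rw [smul_sub, sub_eq_sub_iff_add_eq_add, hxy, add_comm]
    have h2 : ‖x - y‖ ≤ t * (L * ‖x - y‖) := by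
      conv_lhs => rw [h1, norm_smul, Real.norm_of_nonneg ht0, norm_sub_rev]
      exact mul_le_mul_of_nonneg_left (hw x hx y hy) ht0
    rw [← sub_eq_zero, ← norm_eq_zero]
    nlinarith [norm_nonneg (x - y), mul_nonneg ht0 hL]
  · rw [mem_closedBall_zero_iff] at hy
    have hK : 0 ≤ t * (2 * L) := by positivity
    have hc : ContractingWith (NNReal.mk (t * (2 * L)) hK) (fun x => y - t • u x) := by
      refine ⟨by exact_mod_cast htL, LipschitzWith.of_dist_le_mul fun a b => ?_⟩
      rw [dist_eq_norm, dist_eq_norm]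
      have : y - t • u a - (y - t • u b) = t • (u b - u a) := by module
      rw [this, norm_smul, Real.norm_of_nonneg ht0, norm_sub_rev, NNReal.coe_mk, mul_assoc]
      exact mul_le_mul_of_nonneg_left (hu a b) ht0
    have hfix := hc.fixedPoint_isFixedPt
    set x := ContractingWith.fixedPoint _ hc
    have hx : y - t • u x = x := hfix
    have hxR : ‖x‖ ≤ R := by
      by_contra hcon
      simp only [u, hcon, if_false, smul_zero, sub_zero] at hx
      exact hcon (hx ▸ hy)
    refine ⟨x, mem_closedBall_zero_iff.2 hxR, ?_⟩
    simp only [u, hxR, if_true] at hx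
    exact (sub_eq_iff_eq_add.1 hx).symm

theorem ContinuousLinearMap.det_eq_zero_of_forall_inner_eq_zero {E : Type*}
    [NormedAddCommGroup E] [InnerProductSpace ℝ E] [FiniteDimensional ℝ E] {A : E →L[ℝ] E} {y : E}
    (hy : y ≠ 0) (h : ∀ v, inner ℝ y (A v) = 0) : A.det = 0 := by
  by_contra hdet
  have hdet' : LinearMap.det (A : E →ₗ[ℝ] E) ≠ 0 := hdet
  obtain ⟨v, hv⟩ := (LinearMap.equivOfDetNeZero _ hdet').surjective y
  have hv' : A v = y := hv
  have := h v
  rw [hv', inner_self_eq_zero] at this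
  exact hy this

/-- A `C¹` map equal to the identity outside a ball has a zero. -/
theorem exists_eq_zero_of_contDiff_of_eq_self {E : Type*} [NormedAddCommGroup E]
    [InnerProductSpace ℝ E] [FiniteDimensional ℝ E] {h : E → E} (hh : ContDiff ℝ 1 h) {R : ℝ}
    (hR : 0 < R) (hid : ∀ x, R ≤ ‖x‖ → h x = x) : ∃ x, h x = 0 := by
  borelize E
  by_contra! hne
  let r : E → E := fun x => (R * ‖h x‖⁻¹) • h x
  have hrC : ContDiff ℝ 1 r :=
    (contDiff_const.mul ((hh.norm ℝ hne).inv fun x => norm_ne_zero_iff.2 (hne x))).smul hh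
  have hrn (x : E) : ‖r x‖ = R := by
    have := norm_pos_iff.2 (hne x)
    rw [norm_smul, Real.norm_of_nonneg (by positivity)]
    field_simp
  let w : E → E := fun x => r x - x
  have hwC : ContDiff ℝ 1 w := hrC.sub contDiff_id
  have hwd : Differentiable ℝ w := hwC.differentiable one_ne_zero
  have hw'c : Continuous (fderiv ℝ w) := hwC.continuous_fderiv one_ne_zero
  have hw0 (x : E) (hx : ‖x‖ = R) : w x = 0 := by
    simp only [w, r, hid x hx.ge, hx]
    rw [mul_inv_cancel₀ hR.ne', one_smul, sub_self]
  have hwB (x : E) (_ : ‖x‖ ≤ R) : ‖x + w x‖ ≤ R := by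
    simp only [w, add_sub_cancel, hrn, le_refl]
  set B : Set E := Metric.closedBall 0 R
  have hBc : IsCompact B := isCompact_closedBall 0 R
  obtain ⟨L, hL⟩ := hBc.exists_bound_of_continuousOn hw'c.continuousOn
  have hL0 : 0 ≤ L := (norm_nonneg _).trans (hL 0 (Metric.mem_closedBall_self hR.le))
  have hwL (x : E) (hx : ‖x‖ ≤ R) (y : E) (hy : ‖y‖ ≤ R) : ‖w x - w y‖ ≤ L * ‖x - y‖ :=
    (convex_closedBall (0 : E) R).norm_image_sub_le_of_norm_fderiv_le (fun z _ => hwd z) hL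
      (mem_closedBall_zero_iff.2 hy) (mem_closedBall_zero_iff.2 hx)
  obtain ⟨δ, hδ, hdet⟩ : ∃ δ > 0, ∀ A : E →L[ℝ] E, ‖A‖ < δ → 0 < (1 + A).det := by
    have hc : Continuous fun A : E →L[ℝ] E => (1 + A).det :=
      ContinuousLinearMap.continuous_det.comp (continuous_const.add continuous_id)
    have h1 : ∀ᶠ A in 𝓝 (0 : E →L[ℝ] E), 0 < (1 + A).det := by
      refine hc.continuousAt.eventually (lt_mem_nhds ?_)
      change 0 < (1 + 0 : E →L[ℝ] E).det
      rw [add_zero]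
      change 0 < LinearMap.det (LinearMap.id : E →ₗ[ℝ] E)
      rw [LinearMap.det_id]
      exact one_pos
    obtain ⟨δ, hδ, hball⟩ := Metric.eventually_nhds_iff.1 h1
    exact ⟨δ, hδ, fun A hA => hball (by rwa [dist_zero_right])⟩
  obtain ⟨τ, hτ, hτ1, hτL, hτδ⟩ : ∃ τ : ℝ, 0 < τ ∧ τ ≤ 1 ∧ τ * (2 * L) < 1 ∧ τ * L < δ := by
    have h2 : ∀ᶠ τ in 𝓝[>] (0 : ℝ), τ * (2 * L) < 1 ∧ τ * L < δ ∧ τ ≤ 1 := by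
      refine nhdsWithin_le_nhds ?_
      refine Filter.Eventually.and ?_ (Filter.Eventually.and ?_ (Iic_mem_nhds one_pos))
      · exact (continuous_id.mul continuous_const).continuousAt.eventually
          (gt_mem_nhds (by simp))
      · exact (continuous_id.mul continuous_const).continuousAt.eventually
          (gt_mem_nhds (by simpa using hδ))
    obtain ⟨τ, ⟨h3, h4, h5⟩, h6⟩ := (h2.and self_mem_nhdsWithin).exists
    exact ⟨τ, h6, h5, h3, h4⟩
  have hvol (t : ℝ) (ht0 : 0 ≤ t) (ht : t ≤ τ) :
      ∫ x in B, (1 + t • fderiv ℝ w x).det = MeasureTheory.volume.real B := by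
    have hbij := bijOn_closedBall_add_smul hR hL0 hwL hw0 hwB ht0 (ht.trans hτ1)
      (lt_of_le_of_lt (by gcongr) hτL)
    have hderiv (x : E) (_ : x ∈ B) : HasFDerivWithinAt (fun x => x + t • w x)
        (1 + t • fderiv ℝ w x) B x :=
      ((hasFDerivAt_id x).add ((hwd x).hasFDerivAt.const_smul t)).hasFDerivWithinAt
    have := MeasureTheory.integral_image_eq_integral_abs_det_fderiv_smul MeasureTheory.volume
      Metric.isClosed_closedBall.measurableSet hderiv hbij.injOn (fun _ => (1 : ℝ))
    rw [hbij.image_eq, MeasureTheory.setIntegral_const, smul_eq_mul, mul_one] at this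
    rw [this]
    refine MeasureTheory.setIntegral_congr_fun Metric.isClosed_closedBall.measurableSet
      fun x hx => ?_
    rw [smul_eq_mul, mul_one, abs_of_pos]
    refine hdet _ ?_
    rw [norm_smul, Real.norm_of_nonneg ht0]
    exact lt_of_le_of_lt (mul_le_mul ht (hL x hx) (norm_nonneg _) hτ.le) hτδ
  have hone (x : E) : (1 + fderiv ℝ w x).det = 0 := by
    have hrd : HasFDerivAt r (1 + fderiv ℝ w x) x := by
      have : r = fun x => x + w x := by ext; simp [w]
      rw [this]
      exact (hasFDerivAt_id x).add (hwd x).hasFDerivAt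
    refine ContinuousLinearMap.det_eq_zero_of_forall_inner_eq_zero
      (y := r x) (norm_pos_iff.1 (by rw [hrn]; exact hR)) fun v => ?_
    have h1 := hrd.norm_sq
    have h2 : HasFDerivAt (fun x => ‖r x‖ ^ 2) (0 : E →L[ℝ] ℝ) x := by
      simp only [hrn]
      exact hasFDerivAt_const _ _
    have h3 := congrArg (fun T : E →L[ℝ] ℝ => T v) (h1.unique h2)
    have h4 : (2 : ℝ) * inner ℝ (r x) ((1 + fderiv ℝ w x) v) = 0 := by
      simpa [mul_add, inner_add_right] using h3
    linarith
  let v : ℕ → ℝ := fun j => τ / (j + 1)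
  have hv : Function.Injective v := fun i j hij => by
    simp only [v] at hij
    field_simp at hij
    exact_mod_cast (add_right_cancel hij).symm
  have hint (j : ℕ) : MeasureTheory.IntegrableOn
      (fun x => (1 + v j • fderiv ℝ w x).det) B := by
    refine Continuous.continuousOn ?_ |>.integrableOn_compact hBc
    have hc : Continuous fun x => 1 + v j • fderiv ℝ w x := by fun_prop
    exact ContinuousLinearMap.continuous_det.comp hc
  set s := Finset.range (Module.finrank ℝ E + 1) with hs
  have hzero : ∫ x in B, (1 + fderiv ℝ w x).det = 0 := by
    simp only [hone, MeasureTheory.integral_zero]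
  have hsum : ∑ j ∈ s, (Lagrange.basis s v j).eval 1 = 1 := by
    rw [← Polynomial.eval_finsetSum, Lagrange.sum_basis hv.injOn ⟨0, by simp [hs]⟩,
      Polynomial.eval_one]
  rw [MeasureTheory.integral_congr_ae (.of_forall fun x =>
    ContinuousLinearMap.det_one_add_eq_sum_lagrange hv (fderiv ℝ w x))] at hzero
  rw [MeasureTheory.integral_finsetSum _ fun j _ => (hint j).const_mul _] at hzero
  have hterm (j : ℕ) : ∫ x in B, (Lagrange.basis s v j).eval 1 * (1 + v j • fderiv ℝ w x).det =
      (Lagrange.basis s v j).eval 1 * MeasureTheory.volume.real B := by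
    rw [MeasureTheory.integral_const_mul, hvol (v j) (by positivity)
      (div_le_self hτ.le (by linarith [(Nat.cast_nonneg j : (0 : ℝ) ≤ j)]))]
  rw [Finset.sum_congr rfl fun j _ => hterm j, ← Finset.sum_mul, hsum, one_mul] at hzero
  have hpos : 0 < MeasureTheory.volume.real B :=
    ENNReal.toReal_pos (Metric.measure_closedBall_pos _ _ hR).ne' hBc.measure_ne_top
  exact hpos.ne' hzero

open scoped Manifold ContDiff in
theorem exists_fixedPoint_of_continuous_of_bounded_inner {E : Type*} [NormedAddCommGroup E]
    [InnerProductSpace ℝ E] [FiniteDimensional ℝ E] {g : E → E} (hg : Continuous g) {M : ℝ}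
    (hM : ∀ x, ‖g x‖ ≤ M) : ∃ x, g x = x := by
  by_contra! hne
  have hM0 : 0 ≤ M := (norm_nonneg _).trans (hM 0)
  let t : E → Set E := fun x => {v | (‖x‖ ≤ M + 1 → ‖v + g x‖ < ‖x - g x‖) ∧ ‖v‖ < M + 1 ∧
    (M + 2 ≤ ‖x‖ → v = 0)}
  have ht (x : E) : Convex ℝ (t x) := by
    refine Convex.inter ?_ (Convex.inter ?_ ?_)
    · by_cases hx : ‖x‖ ≤ M + 1
      · simp only [hx, true_imp_iff]
        have h : {v | ‖v + g x‖ < ‖x - g x‖} = Metric.ball (-g x) ‖x - g x‖ := by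
          ext v
          simp [dist_eq_norm]
        change Convex ℝ {v | ‖v + g x‖ < ‖x - g x‖}
        rw [h]
        exact convex_ball _ _
      · simp only [hx, false_imp_iff]
        exact convex_univ
    · have h : {v : E | ‖v‖ < M + 1} = Metric.ball 0 (M + 1) := by
        ext v
        simp
      change Convex ℝ {v : E | ‖v‖ < M + 1}
      rw [h]
      exact convex_ball _ _
    · by_cases hx : M + 2 ≤ ‖x‖
      · simp only [hx, true_imp_iff]
        exact convex_singleton 0
      · simp only [hx, false_imp_iff]
        exact convex_univ
  have hloc (x : E) : ∃ c : E, ∀ᶠ y in 𝓝 x, c ∈ t y := by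
    rcases lt_or_ge ‖x‖ (M + 2) with hx | hx
    · refine ⟨-g x, ?_⟩
      have h1 : ∀ᶠ y in 𝓝 x, ‖-g x + g y‖ < ‖y - g y‖ :=
        (isOpen_lt (by fun_prop) (by fun_prop)).mem_nhds
          (by simpa [sub_eq_zero] using (hne x).symm)
      have h2 : ∀ᶠ y in 𝓝 x, ‖y‖ < M + 2 := (isOpen_lt (by fun_prop) (by fun_prop)).mem_nhds hx
      filter_upwards [h1, h2] with y hy1 hy2
      exact ⟨fun _ => hy1, by rw [norm_neg]; linarith [hM x], fun h => absurd h (not_le.2 hy2)⟩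
    · refine ⟨0, ?_⟩
      have h2 : ∀ᶠ y in 𝓝 x, M + 1 < ‖y‖ :=
        (isOpen_lt (by fun_prop) (by fun_prop)).mem_nhds (by change M + 1 < ‖x‖; linarith)
      filter_upwards [h2] with y hy
      exact ⟨fun h => absurd h (not_le.2 hy), by rw [norm_zero]; linarith, fun _ => rfl⟩
  obtain ⟨v, hv⟩ := exists_contMDiffMap_forall_mem_convex_of_local_const (n := 1) 𝓘(ℝ, E) ht hloc
  have hvC : ContDiff ℝ 1 v := v.contMDiff.contDiff
  obtain ⟨x, hx⟩ := exists_eq_zero_of_contDiff_of_eq_self (h := fun x => x + v x)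
    (contDiff_id.add hvC) (R := M + 2) (by linarith)
    (fun x hx => by rw [(hv x).2.2 hx, add_zero])
  have hvx : v x = -x := (neg_eq_of_add_eq_zero_right hx).symm
  obtain ⟨h1, h2, -⟩ := hv x
  rw [hvx, norm_neg] at h2
  have := h1 h2.le
  rw [hvx, neg_add_eq_sub, norm_sub_rev] at this
  exact lt_irrefl _ this

/-- **Brouwer's fixed point theorem** for bounded continuous maps of a whole space. -/
theorem exists_fixedPoint_of_continuous_of_isBounded_range {E : Type*} [NormedAddCommGroup E]
    [NormedSpace ℝ E] [FiniteDimensional ℝ E] {g : E → E} (hg : Continuous g)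
    (hb : Bornology.IsBounded (range g)) : ∃ x, g x = x := by
  let e := toEuclidean (E := E)
  obtain ⟨M, hM⟩ := hb.exists_norm_le
  obtain ⟨x, hx⟩ := exists_fixedPoint_of_continuous_of_bounded_inner
    (g := fun x => e (g (e.symm x))) (by fun_prop)
    (M := ‖(e : E →L[ℝ] EuclideanSpace ℝ (Fin (Module.finrank ℝ E)))‖ * M) fun x =>
      (e : E →L[ℝ] EuclideanSpace ℝ (Fin (Module.finrank ℝ E))).le_opNorm_of_le
        (hM _ (mem_range_self _))
  exact ⟨e.symm x, e.injective (by rw [hx, e.apply_symm_apply])⟩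

/-- **Michael's selection theorem**: a lower semicontinuous map with nonempty convex values admits
a continuous selection of the closures of its values. -/
theorem exists_continuous_forall_mem_closure {X E : Type*} [TopologicalSpace X] [NormalSpace X]
    [ParacompactSpace X] [NormedAddCommGroup E] [NormedSpace ℝ E] [CompleteSpace E]
    {Φ : X → Set E} (hne : ∀ x, (Φ x).Nonempty) (hconv : ∀ x, Convex ℝ (Φ x))
    (hlsc : ∀ x, LscAt Φ x) : ∃ g : X → E, Continuous g ∧ ∀ x, g x ∈ closure (Φ x) := by
  have hthick (ε : ℝ) (hε : 0 < ε) (x : X) (y : E) (hy : y ∈ Φ x) :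
      ∀ᶠ x' in 𝓝 x, y ∈ Metric.thickening ε (Φ x') := by
    filter_upwards [hlsc x (Metric.ball y ε) Metric.isOpen_ball ⟨y, hy, Metric.mem_ball_self hε⟩]
      with x' ⟨z, hz, hzy⟩
    exact Metric.mem_thickening_iff.2 ⟨z, hz, by rwa [dist_comm]⟩
  let a : ℕ → ℝ := fun k => 1 / 2 / 2 ^ k
  have ha (k : ℕ) : 0 < a k := by positivity
  let S (k : ℕ) : Type _ := {g : C(X, E) // ∀ x, g x ∈ Metric.thickening (a k) (Φ x)}
  have hstart : Nonempty (S 0) := by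
    obtain ⟨g, hg⟩ := exists_continuous_forall_mem_convex_of_local_const
      (t := fun x => Metric.thickening (a 0) (Φ x)) (fun x => (hconv x).thickening _)
      fun x => ⟨_, hthick _ (ha 0) x _ (hne x).some_mem⟩
    exact ⟨g, hg⟩
  have hstep (k : ℕ) (g : S k) : ∃ g' : S (k + 1), ∀ x : X, dist (g.1 x) (g'.1 x) ≤ a k := by
    have hgk : ∀ x, g.1 x ∈ Metric.thickening (a k) (Φ x) := g.2
    obtain ⟨g', hg'⟩ := exists_continuous_forall_mem_convex_of_local_const
      (t := fun x : X => Metric.thickening (a (k + 1)) (Φ x) ∩ Metric.ball (g.1 x) (a k))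
      (fun x => ((hconv x).thickening _).inter (convex_ball _ _)) fun x => by
        obtain ⟨y, hy, hyd⟩ := Metric.mem_thickening_iff.1 (hgk x)
        refine ⟨y, (hthick _ (ha _) x y hy).and ?_⟩
        have hc : Continuous fun x' : X => dist y (g.1 x') :=
          continuous_const.dist (ContinuousMap.continuous g.1)
        refine hc.continuousAt.eventually (gt_mem_nhds ?_)
        change dist y (g.1 x) < a k
        rwa [dist_comm]
    exact ⟨⟨g', fun x => (hg' x).1⟩, fun x => by
      rw [dist_comm]
      exact (Metric.mem_ball.1 (hg' x).2).le⟩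
  choose next hnext using hstep
  let G : ∀ k, S k := fun k => Nat.rec hstart.some (fun k g => next k g) k
  have hG (x : X) (k : ℕ) : dist ((G k).1 x) ((G (k + 1)).1 x) ≤ a k := hnext k (G k) x
  have hGk (k : ℕ) : ∀ x, (G k).1 x ∈ Metric.thickening (a k) (Φ x) := (G k).2
  choose g hg using fun x => cauchySeq_tendsto_of_complete (cauchySeq_of_le_geometric_two (hG x))
  have hdist (x : X) (k : ℕ) : dist ((G k).1 x) (g x) ≤ 1 / 2 ^ k :=
    dist_le_of_le_geometric_two_of_tendsto (hG x) (hg x) k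
  have hlim : Tendsto (fun k : ℕ => (1 : ℝ) / 2 ^ k) atTop (𝓝 0) := by
    simpa using tendsto_pow_atTop_nhds_zero_of_lt_one (r := (1 / 2 : ℝ)) (by norm_num) (by norm_num)
  refine ⟨g, ?_, fun x => ?_⟩
  · have hu : TendstoUniformly (fun k x => (G k).1 x) g atTop := by
      rw [Metric.tendstoUniformly_iff]
      intro ε hε
      filter_upwards [hlim.eventually (gt_mem_nhds hε)] with k hk x
      rw [dist_comm]
      exact (hdist x k).trans_lt hk
    exact hu.continuous (.of_forall fun k => (G k).1.continuous)
  · rw [Metric.mem_closure_iff]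
    intro ε hε
    obtain ⟨k, hk⟩ := (hlim.eventually (gt_mem_nhds (half_pos hε))).exists
    obtain ⟨y, hy, hyd⟩ := Metric.mem_thickening_iff.1 (hGk k x)
    refine ⟨y, hy, ?_⟩
    have h1 := dist_triangle_left (g x) y ((G k).1 x)
    have h2 := hdist x k
    have h3 : a k ≤ 1 / 2 ^ k := by
      simp only [a]
      gcongr
      norm_num
    linarith

/-- Proper separation of the origin from a convex set of full span. -/
theorem Convex.exists_forall_le_zero_of_span_eq_top {W : Type*} [NormedAddCommGroup W]
    [NormedSpace ℝ W] [FiniteDimensional ℝ W] {S : Set W} (hS : Convex ℝ S) (hne : S.Nonempty)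
    (h0 : (0 : W) ∉ S) (hspan : Submodule.span ℝ S = ⊤) :
    ∃ φ : W →L[ℝ] ℝ, (∀ s ∈ S, φ s ≤ 0) ∧ ∃ s ∈ S, φ s < 0 := by
  set T := convexHull ℝ (insert 0 S) with hT
  have hTc : Convex ℝ T := convex_convexHull ℝ _
  have hsub : insert 0 S ⊆ T := subset_convexHull ℝ _
  have hint : (interior T).Nonempty := by
    rw [hT, interior_convexHull_nonempty_iff_affineSpan_eq_top,
      AffineSubspace.affineSpan_eq_top_iff_vectorSpan_eq_top_of_nonempty ℝ W W
        (insert_nonempty _ _), vectorSpan_eq_span_vsub_set_right ℝ (mem_insert 0 S), eq_top_iff,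
      ← hspan]
    refine Submodule.span_mono fun s hs => ⟨s, mem_insert_of_mem _ hs, by simp⟩
  have h0int : (0 : W) ∉ interior T := fun hmem => by
    obtain ⟨s, hs⟩ := hne
    have hcont : Tendsto (fun ε : ℝ => -(ε • s)) (𝓝[>] 0) (𝓝 0) := by
      have : Continuous fun ε : ℝ => -(ε • s) := by fun_prop
      simpa using (this.tendsto 0).mono_left nhdsWithin_le_nhds
    obtain ⟨ε, hεT, hε⟩ := ((hcont.eventually (mem_interior_iff_mem_nhds.1 hmem)).and
      self_mem_nhdsWithin).exists
    have hε0 : (0 : ℝ) < ε := hε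
    change -(ε • s) ∈ T at hεT
    rw [hT, convexHull_insert ⟨s, hs⟩, hS.convexHull_eq] at hεT
    simp only [convexJoin_singleton_left, mem_iUnion] at hεT
    obtain ⟨z, hz, a, b, ha, hb, hab, hsum⟩ := hεT
    rw [smul_zero, zero_add] at hsum
    have h1 := hS hs hz (a := ε / (ε + b)) (b := b / (ε + b)) (by positivity) (by positivity)
      (by field_simp)
    have h2 : (ε / (ε + b)) • s + (b / (ε + b)) • z = (0 : W) := by
      rw [div_eq_inv_mul, div_eq_inv_mul, mul_smul, mul_smul, hsum, ← smul_add, add_neg_cancel,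
        smul_zero]
    exact h0 (h2 ▸ h1)
  obtain ⟨φ, hφ⟩ := geometric_hahn_banach_open_point hTc.interior isOpen_interior h0int
  have hle (s : W) (hs : s ∈ T) : φ s ≤ 0 := by
    have hcl : s ∈ closure (interior T) := by
      rw [hTc.closure_interior_eq_closure_of_nonempty_interior hint]
      exact subset_closure hs
    refine closure_minimal (fun y hy => ?_) (isClosed_le φ.continuous continuous_const) hcl
    exact ((hφ y hy).trans_eq (map_zero φ)).le
  refine ⟨φ, fun s hs => hle s (hsub (mem_insert_of_mem _ hs)), ?_⟩
  by_contra! hcon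
  have hzero : (φ : W →ₗ[ℝ] ℝ) = 0 := by
    refine LinearMap.ext_on hspan fun s hs => ?_
    exact le_antisymm (hle s (hsub (mem_insert_of_mem _ hs))) (hcon s hs)
  obtain ⟨y, hy⟩ := hint
  have h1 := hφ y hy
  rw [map_zero] at h1
  exact h1.ne (LinearMap.congr_fun hzero y)

/-- Proper separation of a point from a convex set in a finite-dimensional space. -/
theorem Convex.exists_forall_le_of_notMem {E : Type*} [NormedAddCommGroup E] [NormedSpace ℝ E]
    [FiniteDimensional ℝ E] {S : Set E} (hS : Convex ℝ S) (hne : S.Nonempty) {p : E}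
    (hp : p ∉ S) : ∃ φ : E →L[ℝ] ℝ, (∀ s ∈ S, φ s ≤ φ p) ∧ ∃ s ∈ S, φ s < φ p := by
  let S' : Set E := (fun x => x - p) '' S
  let W := Submodule.span ℝ S'
  let T : Set W := Subtype.val ⁻¹' S'
  have hS' : Convex ℝ S' := by
    simpa only [neg_add_eq_sub] using hS.translate (-p)
  have hTmem (s : E) (hs : s ∈ S) : (⟨s - p, Submodule.subset_span ⟨s, hs, rfl⟩⟩ : W) ∈ T :=
    ⟨s, hs, rfl⟩
  obtain ⟨s₀, hs₀⟩ := hne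
  obtain ⟨φ, hφ, s, hs, hlt⟩ := Convex.exists_forall_le_zero_of_span_eq_top (S := T)
    (hS'.linear_preimage W.subtype) ⟨_, hTmem s₀ hs₀⟩
    (fun ⟨s, hs, hsp⟩ => hp (sub_eq_zero.1 hsp ▸ hs)) Submodule.span_span_coe_preimage
  obtain ⟨ψ, hψ⟩ := LinearMap.exists_extend (φ : W →ₗ[ℝ] ℝ)
  have hψφ (x : W) : ψ x = φ x := LinearMap.congr_fun hψ x
  refine ⟨ψ.toContinuousLinearMap, fun s hs => ?_, ?_⟩
  · have := hφ _ (hTmem s hs)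
    rw [← hψφ, map_sub, sub_nonpos] at this
    exact this
  · obtain ⟨z, hz, hzs⟩ := hs
    refine ⟨z, hz, ?_⟩
    rw [← hψφ, ← hzs, map_sub, sub_neg] at hlt
    exact hlt

/-- An infinite convex combination with positive weights of a dense sequence in a convex subset of
a finite-dimensional space belongs to that set. -/
theorem Convex.tsum_geometric_smul_mem {E : Type*} [NormedAddCommGroup E] [NormedSpace ℝ E]
    [FiniteDimensional ℝ E] {S : Set E} (hS : Convex ℝ S) (hne : S.Nonempty) {y : ℕ → E}
    (hy : ∀ i, y i ∈ closure S) (hd : S ⊆ closure (range y))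
    (hsum : Summable fun i => ((1 : ℝ) / 2 / 2 ^ i) • y i) :
    ∑' i, ((1 : ℝ) / 2 / 2 ^ i) • y i ∈ S := by
  by_contra hp
  set p := ∑' i, ((1 : ℝ) / 2 / 2 ^ i) • y i
  obtain ⟨φ, hle, s, hs, hlt⟩ := hS.exists_forall_le_of_notMem hne hp
  have hle' (i : ℕ) : φ (y i) ≤ φ p :=
    closure_minimal hle (isClosed_le φ.continuous continuous_const) (hy i)
  have h1 : HasSum (fun i : ℕ => (1 : ℝ) / 2 / 2 ^ i * φ (y i)) (φ p) := by
    simpa only [map_smul, smul_eq_mul] using hsum.hasSum.mapL φ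
  have h2 : HasSum (fun i : ℕ => (1 : ℝ) / 2 / 2 ^ i * φ p) (φ p) := by
    simpa using (hasSum_geometric_two' (1 : ℝ)).mul_right (φ p)
  have h3 : HasSum (fun i : ℕ => (1 : ℝ) / 2 / 2 ^ i * (φ p - φ (y i))) 0 := by
    simpa [mul_sub] using h2.sub h1
  have h4 := (hasSum_zero_iff_of_nonneg fun i =>
    mul_nonneg (by positivity) (sub_nonneg.2 (hle' i))).1 h3
  have h5 (i : ℕ) : φ (y i) = φ p := by
    have := congrFun h4 i
    have hpos : (1 : ℝ) / 2 / 2 ^ i ≠ 0 := by positivity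
    exact (sub_eq_zero.1 ((mul_eq_zero.1 this).resolve_left hpos)).symm
  have h6 : φ s = φ p :=
    closure_minimal (range_subset_iff.2 h5) (isClosed_eq φ.continuous continuous_const) (hd hs)
  exact hlt.ne h6

/-- Restricting a lower semicontinuous map to an open set of values on a closed set of points
preserves lower semicontinuity. -/
theorem LscAt.ite_inter {X Y : Type*} [TopologicalSpace X] [TopologicalSpace Y] {Φ : X → Set Y}
    {A : Set X} [DecidablePred (· ∈ A)] (hA : IsClosed A) {U : Set Y} (hU : IsOpen U) {x : X}
    (h : LscAt Φ x) : LscAt (fun z => if z ∈ A then Φ z ∩ U else Φ z) x := by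
  intro Ω hΩ hne
  by_cases hx : x ∈ A
  · simp only [hx, if_true, inter_assoc] at hne
    filter_upwards [h _ (hU.inter hΩ) hne] with z hz
    split_ifs
    · rwa [inter_assoc]
    · exact hz.mono fun y hy => ⟨hy.1, hy.2.2⟩
  · simp only [hx, if_false] at hne
    filter_upwards [h Ω hΩ hne, hA.isOpen_compl.mem_nhds hx] with z hz hzA
    rwa [if_neg hzA]

/-- **Michael's selection theorem** for convex-valued maps into a finite-dimensional space, whose
values are not assumed to be closed. -/
theorem exists_continuous_forall_mem_of_lscAt {X E : Type*} [MetricSpace X]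
    [NormedAddCommGroup E] [NormedSpace ℝ E] [FiniteDimensional ℝ E]
    {Φ : X → Set E} (hne : ∀ x, (Φ x).Nonempty) (hconv : ∀ x, Convex ℝ (Φ x))
    (hlsc : ∀ x, LscAt Φ x) {C : Set E} (hC : Bornology.IsBounded C) (hΦC : ∀ x, Φ x ⊆ C) :
    ∃ g : X → E, Continuous g ∧ ∀ x, g x ∈ Φ x := by
  classical
  let V : ℕ × ℕ → Set E := fun i =>
    Metric.ball (TopologicalSpace.denseSeq E i.1) (1 / ((i.2 : ℝ) + 1))
  have hopen (i : ℕ × ℕ) : IsOpen {x | (Φ x ∩ V i).Nonempty} :=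
    isOpen_iff_mem_nhds.2 fun x hx => hlsc x _ Metric.isOpen_ball hx
  choose A hA _ hAV _ using fun i => (hopen i).exists_iUnion_isClosed
  have hsel (i : ℕ × ℕ) (m : ℕ) : ∃ g : X → E, Continuous g ∧ (∀ x, g x ∈ closure (Φ x)) ∧
      ∀ x ∈ A i m, g x ∈ closure (V i) := by
    obtain ⟨g, hg, hgm⟩ := exists_continuous_forall_mem_closure
      (Φ := fun x => if x ∈ A i m then Φ x ∩ V i else Φ x)
      (fun x => by
        split_ifs with hx
        · have : x ∈ ⋃ m, A i m := mem_iUnion.2 ⟨m, hx⟩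
          rw [hAV] at this
          exact this
        · exact hne x)
      (fun x => by
        split_ifs
        · exact (hconv x).inter (convex_ball _ _)
        · exact hconv x)
      fun x => (hlsc x).ite_inter (hA i m) Metric.isOpen_ball
    refine ⟨g, hg, fun x => closure_mono ?_ (hgm x), fun x hx => closure_mono ?_ (hgm x)⟩
    · split_ifs
      · exact inter_subset_left
      · exact Subset.rfl
    · simp only [hx, if_true, inter_subset_right]
  choose G hGc hGm hGV using hsel
  obtain ⟨e, he⟩ := exists_surjective_nat ((ℕ × ℕ) × ℕ)
  let y : ℕ → X → E := fun k => G (e k).1 (e k).2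
  obtain ⟨M, hM⟩ := hC.closure.exists_norm_le
  have hbound (k : ℕ) (x : X) : ‖((1 : ℝ) / 2 / 2 ^ k) • y k x‖ ≤ 1 / 2 / 2 ^ k * M := by
    rw [norm_smul, Real.norm_of_nonneg (by positivity)]
    exact mul_le_mul_of_nonneg_left (hM _ (closure_mono (hΦC x) (hGm _ _ x))) (by positivity)
  have hsummable : Summable fun k : ℕ => (1 : ℝ) / 2 / 2 ^ k * M :=
    (summable_geometric_two' 1).mul_right M
  refine ⟨fun x => ∑' k, ((1 : ℝ) / 2 / 2 ^ k) • y k x,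
    continuous_tsum (fun k => (hGc _ _).const_smul _) hsummable hbound, fun x => ?_⟩
  refine (hconv x).tsum_geometric_smul_mem (hne x) (fun k => hGm _ _ x) (fun z hz => ?_)
    (hsummable.of_norm_bounded fun k => hbound k x)
  rw [Metric.mem_closure_iff]
  intro ε hε
  obtain ⟨k, hk⟩ := exists_nat_one_div_lt (half_pos hε)
  obtain ⟨-, ⟨j, rfl⟩, hj⟩ := Metric.mem_closure_iff.1
    (TopologicalSpace.denseRange_denseSeq E z) (1 / ((k : ℝ) + 1)) (by positivity)
  have hx : x ∈ ⋃ m, A (j, k) m := by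
    rw [hAV]
    exact ⟨z, hz, hj⟩
  obtain ⟨m, hm⟩ := mem_iUnion.1 hx
  obtain ⟨i, hi⟩ := he ((j, k), m)
  refine ⟨y i x, mem_range_self i, ?_⟩
  have h1 : y i x ∈ closure (V (j, k)) := by
    simp only [y, hi]
    exact hGV _ _ x hm
  have h2 : dist (y i x) (TopologicalSpace.denseSeq E j) ≤ 1 / ((k : ℝ) + 1) :=
    Metric.closure_ball_subset_closedBall h1
  have h3 := dist_triangle_right z (y i x) (TopologicalSpace.denseSeq E j)
  linarith

/-- A lower semicontinuous map with nonempty convex values from a compact convex subset of a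
finite-dimensional space to itself has a fixed point. -/
theorem exists_mem_of_lscAt {E : Type*} [NormedAddCommGroup E] [NormedSpace ℝ E]
    [FiniteDimensional ℝ E] {C : Set E} (hCne : C.Nonempty) (hCconv : Convex ℝ C)
    (hCcomp : IsCompact C) {G : C → Set C} (hne : ∀ x, (G x).Nonempty)
    (hconv : ∀ x, Convex ℝ (Subtype.val '' G x)) (hlsc : ∀ x, LscAt G x) : ∃ x, x ∈ G x := by
  classical
  let Φ : E → Set E := fun x => if hx : x ∈ C then Subtype.val '' G ⟨x, hx⟩ else C
  have hΦC (x : E) : Φ x ⊆ C := by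
    simp only [Φ]
    split_ifs
    · exact Subtype.coe_image_subset _ _
    · exact Subset.rfl
  obtain ⟨g, hg, hgΦ⟩ := exists_continuous_forall_mem_of_lscAt (Φ := Φ)
    (fun x => by
      simp only [Φ]
      split_ifs
      · exact (hne _).image _
      · exact hCne)
    (fun x => by
      simp only [Φ]
      split_ifs
      · exact hconv _
      · exact hCconv)
    (fun x Ω hΩ hx => by
      by_cases hxC : x ∈ C
      · simp only [Φ, hxC, dif_pos] at hx
        obtain ⟨-, ⟨y, hy, rfl⟩, hyΩ⟩ := hx
        have h := hlsc ⟨x, hxC⟩ _ (hΩ.preimage continuous_subtype_val) ⟨y, hy, hyΩ⟩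
        rw [nhds_subtype_eq_comap, eventually_comap] at h
        filter_upwards [h] with z hz
        by_cases hzC : z ∈ C
        · obtain ⟨v, hv, hvΩ⟩ := hz ⟨z, hzC⟩ rfl
          refine ⟨v, ?_, hvΩ⟩
          simp only [Φ, hzC, dif_pos]
          exact mem_image_of_mem _ hv
        · refine ⟨y, ?_, hyΩ⟩
          simp only [Φ, hzC, dif_neg, not_false_eq_true]
          exact y.2
      · filter_upwards [hCcomp.isClosed.isOpen_compl.mem_nhds hxC] with z hz
        simp only [Φ, hxC, dif_neg, not_false_eq_true] at hx
        have hz' : z ∉ C := hz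
        simp only [Φ, hz', dif_neg, not_false_eq_true]
        exact hx)
    hCcomp.isBounded hΦC
  obtain ⟨x, hx⟩ := exists_fixedPoint_of_continuous_of_isBounded_range hg
    (hCcomp.isBounded.subset (range_subset_iff.2 fun x => hΦC x (hgΦ x)))
  have hxC : x ∈ C := by
    have := hΦC x (hgΦ x)
    rwa [hx] at this
  have hxΦ := hgΦ x
  simp only [Φ, hx, hxC, dif_pos] at hxΦ
  obtain ⟨y, hy, hyx⟩ := hxΦ
  exact ⟨⟨x, hxC⟩, by rwa [show y = ⟨x, hxC⟩ from Subtype.ext hyx] at hy⟩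

/-- Existence of solutions for quasiequilibrium problems under the weakened diagonal
condition `f x x ≥ 0` for all `x ∈ fix K`: `C ⊆ ℝⁿ` nonempty convex compact,
`K` lower semicontinuous with nonempty convex values and closed fixed point set,
`F x := {y ∈ C : f x y < 0}` convex-valued and lower semicontinuous on `fix K`, and
`F ∩ K` lower semicontinuous on `∂_C fix K`. Then there is `x ∈ K x` with
`f x y ≥ 0` for all `y ∈ K x`. -/
theorem quasiequilibrium_existence_weak_diagonal {n : ℕ} {C : Set (Fin n → ℝ)}
    (hCne : C.Nonempty) (hCconv : Convex ℝ C) (hCcomp : IsCompact C)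
    (K : C → Set C)
    (hKlsc : ∀ x : C, LscAt K x)
    (hKne : ∀ x : C, (K x).Nonempty)
    (hKconv : ∀ x : C, Convex ℝ (Subtype.val '' K x))
    (hfix : IsClosed {x : C | x ∈ K x})
    (f : C → C → ℝ) (hdiag : ∀ x : C, x ∈ K x → 0 ≤ f x x)
    (F : C → Set C) (hF : ∀ x : C, F x = {y : C | f x y < 0})
    (hFconv : ∀ x ∈ {x : C | x ∈ K x}, Convex ℝ (Subtype.val '' F x))
    (hFlsc : ∀ x ∈ {x : C | x ∈ K x}, LscAt F x)
    (hFKlsc : ∀ x ∈ frontier {x : C | x ∈ K x}, LscAt (fun z => F z ∩ K z) x) :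
    ∃ x : C, x ∈ K x ∧ ∀ y ∈ K x, 0 ≤ f x y := by
  classical
  by_contra! hcon
  set S : Set C := {x : C | x ∈ K x} with hS
  have hnon (x : C) (hx : x ∈ S) : (F x ∩ K x).Nonempty := by
    obtain ⟨y, hy, hfy⟩ := hcon x hx
    exact ⟨y, by rw [hF]; exact hfy, hy⟩
  have hfr : frontier S ⊆ S := hfix.frontier_subset
  let G : C → Set C := fun x =>
    if x ∈ interior S then F x else if x ∈ S then F x ∩ K x else K x
  have hGsup (x : C) : F x ∩ K x ⊆ G x := by
    simp only [G]
    split_ifs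
    · exact inter_subset_left
    · exact Subset.rfl
    · exact inter_subset_right
  obtain ⟨x, hx⟩ := exists_mem_of_lscAt hCne hCconv hCcomp (G := G)
    (fun x => by
      simp only [G]
      split_ifs with h1 h2
      · exact (hnon x (interior_subset h1)).mono inter_subset_left
      · exact hnon x h2
      · exact hKne x)
    (fun x => by
      simp only [G]
      split_ifs with h1 h2
      · exact hFconv x (interior_subset h1)
      · rw [image_inter Subtype.val_injective]
        exact (hFconv x h2).inter (hKconv x)
      · exact hKconv x)
    (fun x Ω hΩ hx => by
      by_cases h1 : x ∈ interior S
      · simp only [G, h1, if_true] at hx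
        filter_upwards [hFlsc x (interior_subset h1) Ω hΩ hx, isOpen_interior.mem_nhds h1]
          with z hz hzS
        simpa only [G, hzS, if_true] using hz
      by_cases h2 : x ∈ S
      · simp only [G, h1, h2, if_true, if_false] at hx
        filter_upwards [hFKlsc x ⟨subset_closure h2, h1⟩ Ω hΩ hx] with z hz
        exact hz.mono (inter_subset_inter_left _ (hGsup z))
      · simp only [G, h1, h2, if_false] at hx
        filter_upwards [hKlsc x Ω hΩ hx, hfix.isOpen_compl.mem_nhds h2] with z hz hzS
        have hzS' : z ∉ S := hzS
        have hzi : z ∉ interior S := fun h => hzS (interior_subset h)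
        simpa only [G, hzS', hzi, if_false] using hz)
  by_cases h2 : x ∈ S
  · have hxF : x ∈ F x := by
      simp only [G, h2, if_true] at hx
      split_ifs at hx
      · exact hx
      · exact hx.1
    rw [hF] at hxF
    exact absurd hxF (not_lt.2 (hdiag x h2))
  · have hzi : x ∉ interior S := fun h => h2 (interior_subset h)
    simp only [G, h2, hzi, if_false] at hx
    exact h2 hx
end
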